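/- arXiv:1611.01493 — 2 statements merged into one kernel-verified Lean document; each statement's English description precedes it below -/
import Mathlib

section
/- Let H be a Hopf algebra with invertible antipode and γ a 2-cocycle on H. The map Q(h) = h₍₃₎ u_γ(h₍₁₎) γ̄(S(h₍₂₎) ⊗ h₍₄₎) intertwines the twisted adjoint coaction Ad_γ(h) = h₍₂₎ ⊗ S_γ(h₍₁₎) ·_γ h₍₃₎ with the undeformed adjoint coaction Ad(h) = h₍₂₎ ⊗ S(h₍₁₎)h₍₃₎: (Q ⊗ id) ∘ Ad_γ = Ad ∘ Q. -/
open TensorProduct LinearMap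

noncomputable section

variable (R H : Type*) [CommRing R] [Ring H] [HopfAlgebra R H]

/-- The multiplication of `H` as a linear map. -/
abbrev mulH : H ⊗[R] H →ₗ[R] H := LinearMap.mul' R H

/-- The antipode of `H`. -/
abbrev Sa : H →ₗ[R] H := HopfAlgebra.antipode (R := R)

/-- The comultiplication `h ⊗ k ↦ (h₍₁₎ ⊗ k₍₁₎) ⊗ (h₍₂₎ ⊗ k₍₂₎)` on `H ⊗ H`. -/
def comul2 : H ⊗[R] H →ₗ[R] (H ⊗[R] H) ⊗[R] (H ⊗[R] H) :=
  (tensorTensorTensorComm R H H H H).toLinearMap ∘ₗ map (Coalgebra.comul (R := R)) (Coalgebra.comul (R := R))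

/-- The (Coalgebra.counit (R := R)) `h ⊗ k ↦ ε(h)ε(k)` on `H ⊗ H`. -/
def counit2 : H ⊗[R] H →ₗ[R] R :=
  (TensorProduct.lid R R).toLinearMap ∘ₗ map (Coalgebra.counit (R := R)) (Coalgebra.counit (R := R))

/-- Iterated comultiplication `h ↦ (h₍₁₎ ⊗ h₍₂₎) ⊗ h₍₃₎`. -/
def comul3 : H →ₗ[R] (H ⊗[R] H) ⊗[R] H := map (Coalgebra.comul (R := R)) LinearMap.id ∘ₗ (Coalgebra.comul (R := R))

/-- Iterated comultiplication `h ↦ ((h₍₁₎ ⊗ h₍₂₎) ⊗ h₍₃₎) ⊗ h₍₄₎`. -/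
def comul4 : H →ₗ[R] ((H ⊗[R] H) ⊗[R] H) ⊗[R] H := map (comul3 R H) LinearMap.id ∘ₗ (Coalgebra.comul (R := R))

/-- Convolution product of two functionals with respect to a given comultiplication. -/
def convOn {C : Type*} [AddCommMonoid C] [Module R C]
    (Δc : C →ₗ[R] C ⊗[R] C) (f g : C →ₗ[R] R) : C →ₗ[R] R :=
  LinearMap.mul' R R ∘ₗ map f g ∘ₗ Δc

/-- The comultiplication on the triple tensor product `(H ⊗ H) ⊗ H`. -/
def comulC3 : (H ⊗[R] H) ⊗[R] H →ₗ[R] ((H ⊗[R] H) ⊗[R] H) ⊗[R] ((H ⊗[R] H) ⊗[R] H) :=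
  (tensorTensorTensorComm R (H ⊗[R] H) (H ⊗[R] H) H H).toLinearMap ∘ₗ map (comul2 R H) (Coalgebra.comul (R := R))

/-- `γ` is a 2-cocycle with convolution inverse `γ'` relative to the product `μ`:
convolution invertible, unital, and satisfying the 2-cocycle condition
`γ(g₍₁₎⊗h₍₁₎)γ(g₍₂₎h₍₂₎⊗k) = γ(h₍₁₎⊗k₍₁₎)γ(g⊗h₍₂₎k₍₂₎)`. -/
structure IsCocycle (μ : H ⊗[R] H →ₗ[R] H) (γ γ' : H ⊗[R] H →ₗ[R] R) : Prop where
  cocycle : convOn R (comulC3 R H) (LinearMap.mul' R R ∘ₗ map γ (Coalgebra.counit (R := R))) (γ ∘ₗ map μ LinearMap.id)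
    = convOn R (comulC3 R H)
        (LinearMap.mul' R R ∘ₗ map (Coalgebra.counit (R := R)) γ ∘ₗ (TensorProduct.assoc R H H H).toLinearMap)
        (γ ∘ₗ map LinearMap.id μ ∘ₗ (TensorProduct.assoc R H H H).toLinearMap)
  conv_inv_right : convOn R (comul2 R H) γ γ' = counit2 R H
  conv_inv_left : convOn R (comul2 R H) γ' γ = counit2 R H
  unital_right : ∀ h : H, γ (h ⊗ₜ[R] 1) = (Coalgebra.counit (R := R)) h
  unital_left : ∀ h : H, γ (1 ⊗ₜ[R] h) = (Coalgebra.counit (R := R)) h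

/-- The twisted product `h ·_γ k = γ(h₍₁₎⊗k₍₁₎) h₍₂₎∙k₍₂₎ γ'(h₍₃₎⊗k₍₃₎)`, where `∙` is
the (possibly already deformed) product `μ`. -/
def twistMul (μ : H ⊗[R] H →ₗ[R] H) (γ γ' : H ⊗[R] H →ₗ[R] R) : H ⊗[R] H →ₗ[R] H :=
  (TensorProduct.lid R H).toLinearMap ∘ₗ (TensorProduct.rid R (R ⊗[R] H)).toLinearMap
    ∘ₗ map (map γ μ) γ' ∘ₗ map (comul2 R H) LinearMap.id ∘ₗ comul2 R H

/-- `u_γ(h) = γ(h₍₁₎ ⊗ S(h₍₂₎))`. -/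
def uMap (γ : H ⊗[R] H →ₗ[R] R) : H →ₗ[R] R :=
  γ ∘ₗ map LinearMap.id (Sa R H) ∘ₗ (Coalgebra.comul (R := R))

/-- `ū_γ(h) = γ'(S(h₍₁₎) ⊗ h₍₂₎)`. -/
def ubarMap (γ' : H ⊗[R] H →ₗ[R] R) : H →ₗ[R] R :=
  γ' ∘ₗ map (Sa R H) LinearMap.id ∘ₗ (Coalgebra.comul (R := R))

/-- The twisted antipode `S_γ(h) = u_γ(h₍₁₎) S(h₍₂₎) ū_γ(h₍₃₎)`. -/
def Stw (γ γ' : H ⊗[R] H →ₗ[R] R) : H →ₗ[R] H :=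
  (TensorProduct.lid R H).toLinearMap ∘ₗ (TensorProduct.rid R (R ⊗[R] H)).toLinearMap
    ∘ₗ map (map (uMap R H γ) (Sa R H)) (ubarMap R H γ') ∘ₗ comul3 R H

/-- The (generalized) right adjoint coaction `h ↦ h₍₂₎ ⊗ S'(h₍₁₎) ∙ h₍₃₎`. -/
def AdGen (S' : H →ₗ[R] H) (μ : H ⊗[R] H →ₗ[R] H) : H →ₗ[R] H ⊗[R] H :=
  map LinearMap.id μ ∘ₗ (TensorProduct.assoc R H H H).toLinearMap
    ∘ₗ map ((TensorProduct.comm R H H).toLinearMap ∘ₗ map S' LinearMap.id) LinearMap.id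
    ∘ₗ comul3 R H

/-- The right adjoint coaction `Ad(h) = h₍₂₎ ⊗ S(h₍₁₎)h₍₃₎`. -/
def Ad : H →ₗ[R] H ⊗[R] H := AdGen R H (Sa R H) (mulH R H)

end

/-- `Q(h) = h₍₃₎ u_γ(h₍₁₎) γ̄(S(h₍₂₎) ⊗ h₍₄₎)`. -/
noncomputable def Qmap (R H : Type*) [CommRing R] [Ring H] [HopfAlgebra R H]
    (γ γ' : H ⊗[R] H →ₗ[R] R) : H →ₗ[R] H :=
  (TensorProduct.lid R H).toLinearMap ∘ₗ (TensorProduct.rid R (R ⊗[R] H)).toLinearMap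
    ∘ₗ map (map (uMap R H γ) LinearMap.id) (γ' ∘ₗ map (Sa R H) LinearMap.id)
    ∘ₗ (tensorTensorTensorComm R H H H H).toLinearMap
    ∘ₗ (TensorProduct.assoc R (H ⊗[R] H) H H).toLinearMap ∘ₗ comul4 R H

/-- `Q⁻¹(h) = h₍₃₎ ū_γ(h₍₂₎) γ(S(h₍₁₎) ⊗ h₍₄₎)`. -/
noncomputable def QinvMap (R H : Type*) [CommRing R] [Ring H] [HopfAlgebra R H]
    (γ γ' : H ⊗[R] H →ₗ[R] R) : H →ₗ[R] H :=
  (TensorProduct.lid R H).toLinearMap ∘ₗ (TensorProduct.lid R (R ⊗[R] H)).toLinearMap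
    ∘ₗ map (γ ∘ₗ map (Sa R H) LinearMap.id) (map (ubarMap R H γ') LinearMap.id)
    ∘ₗ (tensorTensorTensorComm R H H H H).toLinearMap
    ∘ₗ map LinearMap.id (TensorProduct.comm R H H).toLinearMap
    ∘ₗ (TensorProduct.assoc R (H ⊗[R] H) H H).toLinearMap ∘ₗ comul4 R H

open Coalgebra WithConv

namespace HopfAlgebra
variable {R H : Type*} [CommRing R] [Ring H] [HopfAlgebra R H]

lemma comul_comp_antipode :
    comul ∘ₗ antipode R (A := H) =
      (TensorProduct.comm R H H).toLinearMap
        ∘ₗ TensorProduct.map (antipode R) (antipode R) ∘ₗ comul := by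
  apply WithConv.toConv_injective
  let i₁ : H →ₐ[R] H ⊗[R] H := Algebra.TensorProduct.includeLeft
  let i₂ : H →ₐ[R] H ⊗[R] H := Algebra.TensorProduct.includeRight
  have cancel (i : H →ₐ[R] H ⊗[R] H) :
      toConv i.toLinearMap * toConv (i.toLinearMap ∘ₗ antipode R) = 1 := by
    have := LinearMap.algHom_comp_convMul_distrib i (toConv LinearMap.id) (toConv (antipode R))
    rw [LinearMap.id_mul_antipode] at this
    apply WithConv.ofConv_injective
    refine this.symm.trans ?_
    ext; simp
  have hΔ : toConv (comul (R := R) (A := H)) = toConv i₁.toLinearMap * toConv i₂.toLinearMap := by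
    ext h
    simp [(ℛ R h).convMul_apply, i₁, i₂, (ℛ R h).eq]
  have hS : toConv ((TensorProduct.comm R H H).toLinearMap ∘ₗ
      TensorProduct.map (antipode R) (antipode R) ∘ₗ comul) =
      toConv (i₂.toLinearMap ∘ₗ antipode R) * toConv (i₁.toLinearMap ∘ₗ antipode R) := by
    ext h
    simp [(ℛ R h).convMul_apply, i₁, i₂, ← (ℛ R h).eq]
  apply left_inv_eq_right_inv (a := toConv (comul (R := R) (A := H)))
  · have := LinearMap.algHom_comp_convMul_distrib (Bialgebra.comulAlgHom R H)
      (toConv (antipode R)) (toConv LinearMap.id)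
    rw [LinearMap.antipode_mul_id] at this
    apply WithConv.ofConv_injective
    refine Eq.trans this.symm ?_
    ext; simp
  · rw [hΔ, hS, mul_assoc, ← mul_assoc (toConv i₂.toLinearMap), cancel, one_mul, cancel]

end HopfAlgebra

/-- The co-opposite coalgebra of `H`. -/
def Cop (H : Type*) := H

namespace Cop
variable {R H : Type*} [CommRing R]

instance [AddCommGroup H] : AddCommGroup (Cop H) := inferInstanceAs (AddCommGroup H)
instance [AddCommGroup H] [Module R H] : Module R (Cop H) := inferInstanceAs (Module R H)

variable [AddCommGroup H] [Module R H] [Coalgebra R H]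

noncomputable instance : CoalgebraStruct R (Cop H) where
  comul := (TensorProduct.comm R H H).toLinearMap ∘ₗ comul (R := R) (A := H)
  counit := counit (R := R) (A := H)

noncomputable instance : Coalgebra R (Cop H) where
  coassoc := by
    change (TensorProduct.assoc R H H H).toLinearMap
        ∘ₗ LinearMap.rTensor H ((TensorProduct.comm R H H).toLinearMap ∘ₗ comul (R := R) (A := H))
        ∘ₗ ((TensorProduct.comm R H H).toLinearMap ∘ₗ comul (R := R) (A := H)) =
      LinearMap.lTensor H ((TensorProduct.comm R H H).toLinearMap ∘ₗ comul (R := R) (A := H))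
        ∘ₗ ((TensorProduct.comm R H H).toLinearMap ∘ₗ comul (R := R) (A := H))
    ext h
    let φ : H ⊗[R] (H ⊗[R] H) →ₗ[R] H ⊗[R] (H ⊗[R] H) :=
      (TensorProduct.assoc R H H H).toLinearMap ∘ₗ
        LinearMap.rTensor H (TensorProduct.comm R H H).toLinearMap ∘ₗ
          (TensorProduct.comm R H (H ⊗[R] H)).toLinearMap
    convert congr(φ $(coassoc_apply (R := R) h)).symm using 1
    · dsimp [φ]
      induction comul (R := R) h with
      | zero => simp
      | add x y hx hy => simp only [map_add, hx, hy]
      | tmul a b => simp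
    · dsimp [φ]
      induction comul (R := R) h with
      | zero => simp
      | add x y hx hy => simp only [map_add, hx, hy]
      | tmul a b =>
        simp only [TensorProduct.comm_tmul, LinearMap.lTensor_tmul, LinearMap.rTensor_tmul,
          LinearMap.comp_apply, LinearEquiv.coe_coe]
        induction comul (R := R) a with
        | zero => simp
        | add x y hx hy =>
          simp only [map_add, TensorProduct.tmul_add, TensorProduct.add_tmul, hx, hy]
        | tmul c d => simp
  rTensor_counit_comp_comul := by
    change LinearMap.rTensor H (counit (R := R) (A := H))
      ∘ₗ ((TensorProduct.comm R H H).toLinearMap ∘ₗ comul (R := R) (A := H)) = TensorProduct.mk R _ _ 1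
    ext h
    simp [← LinearMap.comm_comp_lTensor_comp_comm_eq]
  lTensor_counit_comp_comul := by
    change LinearMap.lTensor H (counit (R := R) (A := H))
      ∘ₗ ((TensorProduct.comm R H H).toLinearMap ∘ₗ comul (R := R) (A := H)) = (TensorProduct.mk R _ _).flip 1
    ext h
    simp [← LinearMap.comm_comp_rTensor_comp_comm_eq]

end Cop

section Sandwich
variable {R H : Type*} [CommRing R] [Ring H] [HopfAlgebra R H]

/-- The antipode as a morphism of coalgebras from the co-opposite coalgebra. -/
noncomputable def antipodeCoalgHom (R H : Type*) [CommRing R] [Ring H] [HopfAlgebra R H] :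
    Cop H →ₗc[R] H where
  toLinearMap := (HopfAlgebra.antipode (A := H) R : H →ₗ[R] H)
  counit_comp := HopfAlgebra.counit_comp_antipode (A := H)
  map_comp_comul := by
    change TensorProduct.map (HopfAlgebra.antipode R) (HopfAlgebra.antipode R) ∘ₗ
      (TensorProduct.comm R H H).toLinearMap ∘ₗ comul (R := R) (A := H) =
        comul (R := R) (A := H) ∘ₗ HopfAlgebra.antipode R
    rw [HopfAlgebra.comul_comp_antipode]
    ext h
    exact TensorProduct.map_comm _ _ _

/-- The coaction `h ↦ h₍₂₎ ⊗ (h₍₁₎ ⊗ h₍₃₎)` of `Hᶜᵒᵖ ⊗ H` on `H`. -/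
noncomputable def sandwich (R H : Type*) [CommRing R] [Ring H] [HopfAlgebra R H] :
    H →ₗ[R] H ⊗[R] (Cop H ⊗[R] H) :=
  (TensorProduct.assoc R H H H).toLinearMap
    ∘ₗ TensorProduct.map (TensorProduct.comm R H H).toLinearMap LinearMap.id ∘ₗ comul3 R H

lemma comul3_comul3 :
    TensorProduct.map (TensorProduct.assoc R H H H).symm.toLinearMap LinearMap.id ∘ₗ
    (TensorProduct.assoc R (H ⊗[R] (H ⊗[R] H)) H H).toLinearMap ∘ₗ
    TensorProduct.map (TensorProduct.assoc R H (H ⊗[R] H) H).symm.toLinearMap LinearMap.id ∘ₗ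
    TensorProduct.map (TensorProduct.map LinearMap.id (comul3 R H)) LinearMap.id ∘ₗ comul3 R H =
    TensorProduct.map (TensorProduct.map comul LinearMap.id) comul ∘ₗ comul3 R H := by
  simp [comul3, coassoc_simps]

lemma sandwich_coassoc :
    (TensorProduct.assoc R H (Cop H ⊗[R] H) (Cop H ⊗[R] H)).toLinearMap
        ∘ₗ LinearMap.rTensor _ (sandwich R H) ∘ₗ sandwich R H =
      LinearMap.lTensor H (comul (R := R) (A := Cop H ⊗[R] H)) ∘ₗ sandwich R H := by
  let σ : (H ⊗[R] H) ⊗[R] H →ₗ[R] H ⊗[R] (H ⊗[R] H) := (TensorProduct.assoc R H H H).toLinearMap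
    ∘ₗ TensorProduct.map (TensorProduct.comm R H H).toLinearMap LinearMap.id
  let τ : ((H ⊗[R] H) ⊗[R] H) ⊗[R] (H ⊗[R] H) →ₗ[R] H ⊗[R] ((H ⊗[R] H) ⊗[R] (H ⊗[R] H)) :=
    LinearMap.lTensor H ((TensorProduct.tensorTensorTensorComm R H H H H).toLinearMap ∘ₗ
      TensorProduct.map (TensorProduct.comm R H H).toLinearMap LinearMap.id) ∘ₗ
    (TensorProduct.assoc R H (H ⊗[R] H) (H ⊗[R] H)).toLinearMap ∘ₗ
    TensorProduct.map (TensorProduct.comm R (H ⊗[R] H) H).toLinearMap LinearMap.id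
  calc
    _ = ((TensorProduct.assoc R H (H ⊗[R] H) (H ⊗[R] H)).toLinearMap
        ∘ₗ LinearMap.rTensor (H ⊗[R] H) (σ ∘ₗ comul3 R H) ∘ₗ σ) ∘ₗ comul3 R H := rfl
    _ = (τ ∘ₗ TensorProduct.map (TensorProduct.assoc R H H H).symm.toLinearMap LinearMap.id ∘ₗ
        (TensorProduct.assoc R (H ⊗[R] (H ⊗[R] H)) H H).toLinearMap ∘ₗ
        TensorProduct.map ((TensorProduct.assoc R H (H ⊗[R] H) H).symm.toLinearMap) LinearMap.id ∘ₗ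
        TensorProduct.map (TensorProduct.map LinearMap.id (comul3 R H)) LinearMap.id) ∘ₗ
          comul3 R H := by
      congr 1
      ext a b c
      simp only [σ, τ, LinearMap.comp_apply, LinearEquiv.coe_coe, TensorProduct.map_tmul,
        TensorProduct.comm_tmul, TensorProduct.assoc_tmul, LinearMap.rTensor_tmul,
        LinearMap.id_apply, TensorProduct.AlgebraTensorModule.curry_apply,
        TensorProduct.curry_apply, LinearMap.restrictScalars_self]
      induction comul3 R H b with
      | zero => simp
      | add x y hx hy => simp only [map_add, TensorProduct.tmul_add, TensorProduct.add_tmul, hx, hy]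
      | tmul x z =>
        induction x with
        | zero => simp
        | add x y hx hy =>
          simp only [map_add, TensorProduct.tmul_add, TensorProduct.add_tmul, hx, hy]
        | tmul x y => rfl
    _ = τ ∘ₗ TensorProduct.map (TensorProduct.map comul LinearMap.id) comul ∘ₗ comul3 R H := by
      rw [← comul3_comul3]; rfl
    _ = (LinearMap.lTensor H ((TensorProduct.tensorTensorTensorComm R H H H H).toLinearMap ∘ₗ
        TensorProduct.map ((TensorProduct.comm R H H).toLinearMap ∘ₗ comul) comul) ∘ₗ σ) ∘ₗ
          comul3 R H := by
      rw [← LinearMap.comp_assoc]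
      congr 1
      ext a b c
      rfl
    _ = _ := rfl

end Sandwich

section Conv
variable {R H A : Type*} [CommRing R] [Ring H] [HopfAlgebra R H] [Ring A] [Algebra R A]

/-- A functional regarded as an algebra-valued element of the convolution algebra. -/
noncomputable def convScalar {C : Type*} (A : Type*) [AddCommGroup C] [Module R C] [Ring A]
    [Algebra R A] (f : C →ₗ[R] R) : WithConv (C →ₗ[R] A) :=
  toConv (Algebra.linearMap R A ∘ₗ f)

lemma convScalar_mul {C : Type*} [AddCommGroup C] [Module R C] [Coalgebra R C] (f g : C →ₗ[R] R) :
    convScalar A f * convScalar A g = convScalar A (toConv f * toConv g).ofConv := by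
  ext c
  simp [convScalar, (ℛ R c).convMul_apply]

/-- The map `h ↦ h₍₂₎ ⊗ f(h₍₁₎ ⊗ h₍₃₎)`. -/
noncomputable def sandwichWith (f : WithConv (Cop H ⊗[R] H →ₗ[R] A)) : H →ₗ[R] H ⊗[R] A :=
  LinearMap.lTensor H f.ofConv ∘ₗ sandwich R H

/-- The map `h ↦ q(h₍₁₎ ⊗ h₍₃₎) h₍₂₎`. -/
noncomputable def sandwichScalar (q : Cop H ⊗[R] H →ₗ[R] R) : H →ₗ[R] H :=
  (TensorProduct.rid R H).toLinearMap ∘ₗ LinearMap.lTensor H q ∘ₗ sandwich R H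

lemma sandwichWith_mul (f g : WithConv (Cop H ⊗[R] H →ₗ[R] A)) :
    sandwichWith (f * g) = LinearMap.lTensor H (LinearMap.mul' R A ∘ₗ
      TensorProduct.map f.ofConv g.ofConv) ∘ₗ
      (TensorProduct.assoc R H (Cop H ⊗[R] H) (Cop H ⊗[R] H)).toLinearMap
        ∘ₗ LinearMap.rTensor _ (sandwich R H) ∘ₗ sandwich R H := by
  rw [sandwich_coassoc, ← LinearMap.comp_assoc, ← LinearMap.lTensor_comp]
  rfl

lemma rTensor_sandwichScalar_comp_sandwichWith (q : Cop H ⊗[R] H →ₗ[R] R)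
    (f : WithConv (Cop H ⊗[R] H →ₗ[R] A)) :
    LinearMap.rTensor A (sandwichScalar q) ∘ₗ sandwichWith f =
      sandwichWith (convScalar A q * f) := by
  rw [sandwichWith_mul, sandwichWith]
  simp only [← LinearMap.comp_assoc]
  congr 1
  refine TensorProduct.ext' fun m y => ?_
  simp only [sandwichScalar, LinearMap.comp_apply, LinearMap.lTensor_tmul, LinearMap.rTensor_tmul]
  induction sandwich R H m with
  | zero => simp
  | add x y hx hy => simp only [map_add, TensorProduct.add_tmul, hx, hy]
  | tmul m x => simp [convScalar, TensorProduct.smul_tmul, ← Algebra.smul_def]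

lemma sandwichWith_comp_sandwichScalar (q : Cop H ⊗[R] H →ₗ[R] R)
    (f : WithConv (Cop H ⊗[R] H →ₗ[R] A)) :
    sandwichWith f ∘ₗ sandwichScalar q = sandwichWith (f * convScalar A q) := by
  rw [sandwichWith_mul, sandwichScalar]
  simp only [← LinearMap.comp_assoc]
  congr 1
  refine TensorProduct.ext' fun m y => ?_
  simp only [sandwichWith, LinearMap.comp_apply, LinearMap.lTensor_tmul, LinearMap.rTensor_tmul,
    LinearEquiv.coe_coe, TensorProduct.rid_tmul, map_smul]
  induction sandwich R H m with
  | zero => simp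
  | add x y hx hy => simp only [map_add, smul_add, TensorProduct.add_tmul, hx, hy]
  | tmul m x => simp [convScalar, ← Algebra.commutes, ← Algebra.smul_def]

section Coalgebra
variable {C D : Type*} [AddCommGroup C] [Module R C] [Coalgebra R C]
  [AddCommGroup D] [Module R D] [Coalgebra R D]

/-- The functional `u ⊗ ε`. -/
noncomputable def fstScalar (D : Type*) [AddCommGroup D] [Module R D] [Coalgebra R D]
    (u : C →ₗ[R] R) : C ⊗[R] D →ₗ[R] R :=
  LinearMap.mul' R R ∘ₗ TensorProduct.map u counit

/-- The map `c ↦ u(c₍₁₎) c₍₂₎`. -/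
noncomputable def scalarLeft (u : C →ₗ[R] R) : C →ₗ[R] C :=
  (TensorProduct.lid R C).toLinearMap ∘ₗ LinearMap.rTensor C u ∘ₗ comul

/-- The map `c ↦ c₍₁₎ u(c₍₂₎)`. -/
noncomputable def scalarRight (u : C →ₗ[R] R) : C →ₗ[R] C :=
  (TensorProduct.rid R C).toLinearMap ∘ₗ LinearMap.lTensor C u ∘ₗ comul

lemma sum_counit_right_smul {M : Type*} [AddCommGroup M] [Module R M] (f : C →ₗ[R] M) (c : C) :
    ∑ i ∈ (ℛ R c).index, counit (R := R) ((ℛ R c).right i) • f ((ℛ R c).left i) = f c := by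
  simpa only [map_sum, TensorProduct.map_tmul, TensorProduct.rid_tmul, one_smul,
    LinearMap.rTensor_tmul] using
    congr(TensorProduct.rid R M (LinearMap.rTensor R f $(Coalgebra.sum_tmul_counit_eq (ℛ R c))))

lemma sum_counit_left_smul {M : Type*} [AddCommGroup M] [Module R M] (f : C →ₗ[R] M) (c : C) :
    ∑ i ∈ (ℛ R c).index, counit (R := R) ((ℛ R c).left i) • f ((ℛ R c).right i) = f c := by
  simpa only [map_sum, TensorProduct.map_tmul, TensorProduct.lid_tmul, one_smul,
    LinearMap.lTensor_tmul] using
    congr(TensorProduct.lid R M (LinearMap.lTensor R f $(Coalgebra.sum_counit_tmul_eq (ℛ R c))))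

lemma mul_convScalar_fstScalar (f : WithConv (C ⊗[R] D →ₗ[R] A)) (u : C →ₗ[R] R) :
    f * convScalar A (fstScalar D u) =
      toConv (f.ofConv ∘ₗ LinearMap.rTensor D (scalarRight u)) := by
  refine WithConv.ofConv_injective (TensorProduct.ext' fun a c => ?_)
  have h (b : C) := sum_counit_right_smul (f.ofConv ∘ₗ TensorProduct.mk R C D b) c
  simp only [LinearMap.comp_apply, TensorProduct.mk_apply] at h
  simp only [LinearMap.convMul_apply, TensorProduct.comul_tmul, scalarRight, LinearMap.comp_apply,
    LinearMap.rTensor_tmul]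
  induction comul (R := R) a with
  | zero => simp
  | add x y hx hy => simp only [map_add, TensorProduct.add_tmul, hx, hy]
  | tmul x y =>
    rw [← (ℛ R c).eq]
    have hc (r : R) (z : A) : z * algebraMap R A r = r • z := by
      rw [Algebra.smul_def, Algebra.commutes]
    simp [TensorProduct.tmul_sum, convScalar, fstScalar, hc, mul_smul,
      ← Finset.smul_sum, h, ← TensorProduct.smul_tmul', -map_mul]

lemma convScalar_fstScalar_mul (f : WithConv (C ⊗[R] D →ₗ[R] A)) (u : C →ₗ[R] R) :
    convScalar A (fstScalar D u) * f =
      toConv (f.ofConv ∘ₗ LinearMap.rTensor D (scalarLeft u)) := by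
  refine WithConv.ofConv_injective (TensorProduct.ext' fun a c => ?_)
  have h (b : C) := sum_counit_left_smul (f.ofConv ∘ₗ TensorProduct.mk R C D b) c
  simp only [LinearMap.comp_apply, TensorProduct.mk_apply] at h
  simp only [LinearMap.convMul_apply, TensorProduct.comul_tmul, scalarLeft, LinearMap.comp_apply,
    LinearMap.rTensor_tmul]
  induction comul (R := R) a with
  | zero => simp
  | add x y hx hy => simp only [map_add, TensorProduct.add_tmul, hx, hy]
  | tmul x y =>
    rw [← (ℛ R c).eq]
    simp [TensorProduct.tmul_sum, convScalar, fstScalar, ← Algebra.smul_def,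
      ← Finset.smul_sum, h, ← TensorProduct.smul_tmul']

end Coalgebra

end Conv

section Cocycle
variable {R H : Type*} [CommRing R] [Ring H] [HopfAlgebra R H]

lemma convScalar_self {C : Type*} [AddCommGroup C] [Module R C] (f : C →ₗ[R] R) :
    convScalar R f = toConv f := rfl

lemma fstScalar_mul {C D : Type*} [AddCommGroup C] [Module R C] [Coalgebra R C]
    [AddCommGroup D] [Module R D] [Coalgebra R D] (u v : C →ₗ[R] R) :
    toConv (fstScalar D u) * toConv (fstScalar D v) =
      toConv (fstScalar D (toConv u * toConv v).ofConv) := by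
  rw [← convScalar_self (fstScalar D v), mul_convScalar_fstScalar]
  refine WithConv.ofConv_injective (TensorProduct.ext' fun c d => ?_)
  simp only [fstScalar, scalarRight, LinearMap.comp_apply, LinearMap.rTensor_tmul,
    TensorProduct.map_tmul, LinearMap.mul'_apply, LinearMap.convMul_apply]
  congr 1
  induction comul (R := R) c with
  | zero => simp
  | add x y hx hy => simp only [map_add, hx, hy]
  | tmul x y => simp [mul_comm]

lemma fstScalar_counit {C D : Type*} [AddCommGroup C] [Module R C] [Coalgebra R C]
    [AddCommGroup D] [Module R D] [Coalgebra R D] :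
    toConv (fstScalar D (counit (R := R) (A := C))) = 1 := by
  refine WithConv.ofConv_injective (TensorProduct.ext' fun c d => ?_)
  simp [fstScalar, mul_comm]

/-- The map `h ↦ (S(h₍₁₎) ⊗ h₍₂₎) ⊗ S(h₍₃₎)`. -/
noncomputable def antipodeIdAntipode (R H : Type*) [CommRing R] [Ring H] [HopfAlgebra R H] :
    H →ₗ[R] (H ⊗[R] H) ⊗[R] H :=
  TensorProduct.map (TensorProduct.map (Sa R H) LinearMap.id) (Sa R H) ∘ₗ comul3 R H

lemma map_comul_comp_comul3 :
    TensorProduct.map (TensorProduct.map comul comul) comul ∘ₗ comul3 R H =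
    (TensorProduct.assoc R ((H ⊗[R] H) ⊗[R] (H ⊗[R] H)) H H).toLinearMap ∘ₗ
    LinearMap.rTensor H ((TensorProduct.assoc R (H ⊗[R] H) (H ⊗[R] H) H).symm.toLinearMap ∘ₗ
      LinearMap.lTensor (H ⊗[R] H) (TensorProduct.assoc R H H H).symm.toLinearMap ∘ₗ
      (TensorProduct.assoc R H H (H ⊗[R] (H ⊗[R] H))).symm.toLinearMap) ∘ₗ
    (TensorProduct.assoc R H (H ⊗[R] (H ⊗[R] (H ⊗[R] H))) H).symm.toLinearMap ∘ₗ
    LinearMap.lTensor H (LinearMap.rTensor H (LinearMap.lTensor H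
      (LinearMap.lTensor H comul ∘ₗ comul)) ∘ₗ comul3 R H) ∘ₗ comul := by
  simp [comul3, coassoc_simps]

lemma comul_antipode (h : H) : comul (R := R) (Sa R H h) =
    TensorProduct.comm R H H (TensorProduct.map (Sa R H) (Sa R H) (comul h)) :=
  LinearMap.congr_fun HopfAlgebra.comul_comp_antipode h

lemma apply_tmul_mul_antipode (γ : H ⊗[R] H →ₗ[R] R)
    (hγ : ∀ h : H, γ (h ⊗ₜ[R] 1) = counit (R := R) h)
    (x b : H) : γ (x ⊗ₜ[R] LinearMap.mul' R H (LinearMap.lTensor H (Sa R H) (comul b))) =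
      counit (R := R) b * counit (R := R) x := by
  rw [HopfAlgebra.mul_antipode_lTensor_comul_apply, Algebra.algebraMap_eq_smul_one,
    TensorProduct.tmul_smul, map_smul, hγ, smul_eq_mul]

/-- Convolving with `(g ⊗ h) ⊗ k ↦ γ(g ⊗ h k)` has no effect on the elements
`(S(h₍₁₎) ⊗ h₍₂₎) ⊗ S(h₍₃₎)`. -/
lemma convMul_comp_antipodeIdAntipode (F : WithConv ((H ⊗[R] H) ⊗[R] H →ₗ[R] R))
    (γ : H ⊗[R] H →ₗ[R] R) (hγ : ∀ h : H, γ (h ⊗ₜ[R] 1) = counit (R := R) h) :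
    (F * toConv (γ ∘ₗ TensorProduct.map LinearMap.id (mulH R H)
        ∘ₗ (TensorProduct.assoc R H H H).toLinearMap)).ofConv ∘ₗ antipodeIdAntipode R H =
      F.ofConv ∘ₗ antipodeIdAntipode R H := by
  set G := γ ∘ₗ TensorProduct.map LinearMap.id (mulH R H)
        ∘ₗ (TensorProduct.assoc R H H H).toLinearMap with hG
  let Ψ : ((H ⊗[R] H) ⊗[R] (H ⊗[R] H)) ⊗[R] (H ⊗[R] H) →ₗ[R] R :=
    LinearMap.mul' R R ∘ₗ TensorProduct.map F.ofConv G
      ∘ₗ (TensorProduct.tensorTensorTensorComm R (H ⊗[R] H) (H ⊗[R] H) H H).toLinearMap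
      ∘ₗ TensorProduct.map ((TensorProduct.tensorTensorTensorComm R H H H H).toLinearMap
        ∘ₗ TensorProduct.map ((TensorProduct.comm R H H).toLinearMap
          ∘ₗ TensorProduct.map (Sa R H) (Sa R H)) LinearMap.id)
        ((TensorProduct.comm R H H).toLinearMap ∘ₗ TensorProduct.map (Sa R H) (Sa R H))
  have hΨ : (F * toConv G).ofConv ∘ₗ antipodeIdAntipode R H =
      Ψ ∘ₗ (TensorProduct.map (TensorProduct.map comul comul) comul ∘ₗ comul3 R H) := by
    rw [antipodeIdAntipode, ← LinearMap.comp_assoc, ← LinearMap.comp_assoc]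
    congr 1
    ext a b c
    simp [LinearMap.convMul_apply, TensorProduct.comul_tmul, comul_antipode, Ψ]
    rfl
  have key (x a b c : H) :
      Ψ (((TensorProduct.assoc R ((H ⊗[R] H) ⊗[R] (H ⊗[R] H)) H H).toLinearMap ∘ₗ
      LinearMap.rTensor H ((TensorProduct.assoc R (H ⊗[R] H) (H ⊗[R] H) H).symm.toLinearMap ∘ₗ
        LinearMap.lTensor (H ⊗[R] H) (TensorProduct.assoc R H H H).symm.toLinearMap ∘ₗ
        (TensorProduct.assoc R H H (H ⊗[R] (H ⊗[R] H))).symm.toLinearMap) ∘ₗ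
      (TensorProduct.assoc R H (H ⊗[R] (H ⊗[R] (H ⊗[R] H))) H).symm.toLinearMap)
      (x ⊗ₜ ((a ⊗ₜ[R] LinearMap.lTensor H comul (comul (R := R) b)) ⊗ₜ[R] c))) =
      counit (R := R) x * F.ofConv ((Sa R H a ⊗ₜ[R] b) ⊗ₜ[R] Sa R H c) := by
    have h := sum_counit_right_smul (F.ofConv ∘ₗ
      (TensorProduct.mk R (H ⊗[R] H) H).flip (Sa R H c) ∘ₗ TensorProduct.mk R H H (Sa R H a)) b
    simp only [LinearMap.comp_apply, TensorProduct.mk_apply, LinearMap.flip_apply, smul_eq_mul] at h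
    rw [← h, ← (ℛ R b).eq, Finset.mul_sum]
    simp only [map_sum, TensorProduct.tmul_sum, TensorProduct.sum_tmul, LinearMap.lTensor_tmul]
    refine Finset.sum_congr rfl fun i _ => ?_
    have h2 := apply_tmul_mul_antipode γ hγ (Sa R H x) ((ℛ R b).right i)
    rw [HopfAlgebra.counit_antipode] at h2
    rw [mul_left_comm, ← mul_assoc, ← h2, mul_comm]
    induction comul (R := R) ((ℛ R b).right i) with
    | zero => simp
    | add y z hy hz =>
      simp only [map_add, TensorProduct.tmul_add, TensorProduct.add_tmul, hy, hz, mul_add]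
    | tmul y z => simp [Ψ, hG]
  rw [hΨ, map_comul_comp_comul3]
  ext h
  have h3 := sum_counit_left_smul (F.ofConv ∘ₗ antipodeIdAntipode R H) h
  rw [← h3]
  simp only [LinearMap.comp_apply]
  conv_lhs => rw [← (ℛ R h).eq]
  simp only [map_sum]
  refine Finset.sum_congr rfl fun i _ => ?_
  simp only [LinearMap.lTensor_tmul, LinearMap.comp_apply, antipodeIdAntipode]
  induction comul3 R H ((ℛ R h).right i) with
  | zero => simp
  | add y z hy hz => simp only [map_add, TensorProduct.tmul_add, hy, hz, smul_add]
  | tmul y c =>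
    induction y with
    | zero => simp
    | add y z hy hz =>
      simp only [map_add, TensorProduct.tmul_add, TensorProduct.add_tmul, hy, hz, smul_add]
    | tmul a b => exact key _ a b c

lemma map_comul_comul_comp_comul :
    TensorProduct.map comul comul ∘ₗ comul (R := R) (A := H) =
      ((TensorProduct.assoc R (H ⊗[R] H) H H).toLinearMap ∘ₗ
        LinearMap.rTensor H (TensorProduct.assoc R H H H).symm.toLinearMap) ∘ₗ
      LinearMap.rTensor H (LinearMap.lTensor H comul) ∘ₗ comul3 R H := by
  simp [comul3, coassoc_simps]

lemma fstScalar_mul_sndScalar (γ γ' : H ⊗[R] H →ₗ[R] R) :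
    (toConv (fstScalar H γ') * toConv (LinearMap.mul' R R ∘ₗ TensorProduct.map counit γ ∘ₗ
      (TensorProduct.assoc R H H H).toLinearMap)).ofConv =
    LinearMap.mul' R R ∘ₗ TensorProduct.map γ' γ ∘ₗ
      ((TensorProduct.assoc R (H ⊗[R] H) H H).toLinearMap ∘ₗ
        LinearMap.rTensor H (TensorProduct.assoc R H H H).symm.toLinearMap) ∘ₗ
      LinearMap.rTensor H (LinearMap.lTensor H comul) := by
  rw [← convScalar_self (fstScalar H γ'), convScalar_fstScalar_mul]
  ext g h k
  have hg (x y : H) := sum_counit_right_smul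
    ((LinearMap.mul' R R ∘ₗ TensorProduct.map γ' γ) ∘ₗ
      (TensorProduct.mk R (H ⊗[R] H) (H ⊗[R] H)).flip (y ⊗ₜ k) ∘ₗ
      (TensorProduct.mk R H H).flip x) g
  simp only [LinearMap.comp_apply, LinearMap.flip_apply, TensorProduct.mk_apply,
    TensorProduct.map_tmul, LinearMap.mul'_apply] at hg
  simp only [scalarLeft, TensorProduct.AlgebraTensorModule.curry_apply, TensorProduct.curry_apply,
    LinearMap.restrictScalars_self, LinearMap.comp_apply, LinearMap.rTensor_tmul,
    LinearMap.lTensor_tmul, TensorProduct.comul_tmul]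
  induction comul (R := R) h with
  | zero => simp
  | add x y hx hy => simp only [map_add, TensorProduct.tmul_add, TensorProduct.add_tmul, hx, hy]
  | tmul x y =>
    conv_lhs => rw [← (ℛ R g).eq]
    simp [TensorProduct.sum_tmul, ← hg x y, ← TensorProduct.smul_tmul', mul_left_comm]

lemma IsCocycle.convMul_eq_one {γ γ' : H ⊗[R] H →ₗ[R] R}
    (hco : IsCocycle R H (mulH R H) γ γ') : toConv γ' * toConv γ = 1 := by
  refine WithConv.ofConv_injective (hco.conv_inv_left.trans ?_)
  ext g h
  simp [counit2, mul_comm]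

/-- The functional `ū_γ` is a left convolution inverse of `u_γ`. -/
lemma ubarMap_mul_uMap {γ γ' : H ⊗[R] H →ₗ[R] R} (hco : IsCocycle R H (mulH R H) γ γ') :
    toConv (ubarMap R H γ') * toConv (uMap R H γ) = 1 := by
  have hcoc : toConv (fstScalar H γ) * toConv (γ ∘ₗ TensorProduct.map (mulH R H) LinearMap.id) =
      toConv (LinearMap.mul' R R ∘ₗ TensorProduct.map counit γ ∘ₗ
        (TensorProduct.assoc R H H H).toLinearMap) *
      toConv (γ ∘ₗ TensorProduct.map LinearMap.id (mulH R H)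
        ∘ₗ (TensorProduct.assoc R H H H).toLinearMap) := WithConv.ofConv_injective hco.cocycle
  replace hcoc := congr(toConv (fstScalar H γ') * $hcoc)
  have h1 : toConv (fstScalar H γ') * toConv (fstScalar H γ) = 1 := by
    rw [fstScalar_mul, hco.convMul_eq_one]
    exact fstScalar_counit
  rw [← mul_assoc, ← mul_assoc, h1, one_mul] at hcoc
  replace hcoc := congr(WithConv.ofConv $hcoc ∘ₗ antipodeIdAntipode R H)
  rw [convMul_comp_antipodeIdAntipode _ _ hco.unital_right, fstScalar_mul_sndScalar] at hcoc
  refine WithConv.ofConv_injective (Eq.trans ?_ (hcoc.symm.trans ?_))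
  · set Φ := (TensorProduct.assoc R (H ⊗[R] H) H H).toLinearMap ∘ₗ
        LinearMap.rTensor H (TensorProduct.assoc R H H H).symm.toLinearMap with hΦ
    calc
      _ = (LinearMap.mul' R R ∘ₗ TensorProduct.map (γ' ∘ₗ TensorProduct.map (Sa R H) LinearMap.id)
          (γ ∘ₗ TensorProduct.map LinearMap.id (Sa R H))) ∘ₗ
          TensorProduct.map comul comul ∘ₗ comul (R := R) (A := H) := by
        rw [LinearMap.comp_assoc, ← LinearMap.comp_assoc _ _ (TensorProduct.map _ _),
          ← TensorProduct.map_comp]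
        rfl
      _ = (LinearMap.mul' R R ∘ₗ TensorProduct.map (γ' ∘ₗ TensorProduct.map (Sa R H) LinearMap.id)
          (γ ∘ₗ TensorProduct.map LinearMap.id (Sa R H)) ∘ₗ Φ ∘ₗ
            LinearMap.rTensor H (LinearMap.lTensor H comul)) ∘ₗ comul3 R H := by
        rw [map_comul_comul_comp_comul]
        rfl
      _ = _ := by
        rw [antipodeIdAntipode, ← LinearMap.comp_assoc (comul3 R H)]
        congr 1
        ext a b c
        simp only [TensorProduct.AlgebraTensorModule.curry_apply, TensorProduct.curry_apply,
          LinearMap.restrictScalars_self, LinearMap.comp_apply, LinearMap.rTensor_tmul,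
          LinearMap.lTensor_tmul, TensorProduct.map_tmul, LinearMap.id_apply]
        induction comul (R := R) b with
        | zero => simp
        | add x y hx hy =>
          simp only [map_add, TensorProduct.tmul_add, TensorProduct.add_tmul, hx, hy]
        | tmul x y => simp [hΦ]
  · ext h
    have h3 := sum_counit_left_smul (γ ∘ₗ TensorProduct.mk R H H 1 ∘ₗ Sa R H) h
    simp only [LinearMap.comp_apply, TensorProduct.mk_apply, hco.unital_left,
      HopfAlgebra.counit_antipode] at h3
    refine Eq.trans ?_ (h3.trans (by simp))
    simp only [antipodeIdAntipode, comul3, LinearMap.comp_apply]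
    conv_lhs => rw [← (ℛ R h).eq]
    simp only [map_sum, TensorProduct.map_tmul]
    refine Finset.sum_congr rfl fun i _ => ?_
    have h4 : mulH R H (TensorProduct.map (Sa R H) LinearMap.id (comul ((ℛ R h).left i))) =
        counit (R := R) ((ℛ R h).left i) • (1 : H) :=
      (HopfAlgebra.mul_antipode_rTensor_comul_apply _).trans (Algebra.algebraMap_eq_smul_one _)
    simp only [h4, LinearMap.id_apply, ← TensorProduct.smul_tmul', map_smul, hco.unital_left,
      HopfAlgebra.counit_antipode]

end Cocycle

section Intertwining
variable {R H : Type*} [CommRing R] [Ring H] [HopfAlgebra R H]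

lemma AdGen_eq_sandwichWith (S' : H →ₗ[R] H) (T : Cop H →ₗ[R] H) (hT : S' = T)
    (μ : H ⊗[R] H →ₗ[R] H) :
    AdGen R H S' μ = sandwichWith (toConv (μ ∘ₗ LinearMap.rTensor H T)) := by
  subst hT
  have key : TensorProduct.map LinearMap.id μ ∘ₗ (TensorProduct.assoc R H H H).toLinearMap
        ∘ₗ TensorProduct.map ((TensorProduct.comm R H H).toLinearMap
          ∘ₗ TensorProduct.map S' LinearMap.id) LinearMap.id =
      LinearMap.lTensor H (μ ∘ₗ LinearMap.rTensor H S') ∘ₗ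
        (TensorProduct.assoc R H H H).toLinearMap
          ∘ₗ TensorProduct.map (TensorProduct.comm R H H).toLinearMap LinearMap.id := by
    ext a b c
    rfl
  exact congr($key ∘ₗ comul3 R H)

lemma Qmap_eq_sandwichScalar (γ γ' : H ⊗[R] H →ₗ[R] R) (u : Cop H →ₗ[R] R)
    (hu : uMap R H γ = u) :
    Qmap R H γ γ' = sandwichScalar
      ((γ' ∘ₗ LinearMap.rTensor H (antipodeCoalgHom R H).toLinearMap) ∘ₗ
        LinearMap.rTensor H (scalarRight u)) := by
  subst hu
  have h4 : comul4 R H = TensorProduct.map (TensorProduct.map comul LinearMap.id) LinearMap.id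
      ∘ₗ comul3 R H := by
    rw [comul4, comul3, ← LinearMap.comp_assoc, ← TensorProduct.map_comp, LinearMap.id_comp]
  have key : (TensorProduct.lid R H).toLinearMap ∘ₗ (TensorProduct.rid R (R ⊗[R] H)).toLinearMap
      ∘ₗ TensorProduct.map (TensorProduct.map (uMap R H γ) LinearMap.id)
        (γ' ∘ₗ TensorProduct.map (Sa R H) LinearMap.id)
      ∘ₗ (TensorProduct.tensorTensorTensorComm R H H H H).toLinearMap
      ∘ₗ (TensorProduct.assoc R (H ⊗[R] H) H H).toLinearMap
      ∘ₗ TensorProduct.map (TensorProduct.map comul LinearMap.id) LinearMap.id =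
      (TensorProduct.rid R H).toLinearMap
      ∘ₗ LinearMap.lTensor H ((γ' ∘ₗ LinearMap.rTensor H (Sa R H)) ∘ₗ
        LinearMap.rTensor H ((TensorProduct.rid R H).toLinearMap
          ∘ₗ LinearMap.lTensor H (uMap R H γ) ∘ₗ (TensorProduct.comm R H H).toLinearMap ∘ₗ comul))
      ∘ₗ (TensorProduct.assoc R H H H).toLinearMap
      ∘ₗ TensorProduct.map (TensorProduct.comm R H H).toLinearMap LinearMap.id := by
    ext a b c
    simp only [TensorProduct.AlgebraTensorModule.curry_apply, TensorProduct.curry_apply,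
      LinearMap.restrictScalars_self, LinearMap.comp_apply, LinearMap.rTensor_tmul,
      LinearMap.lTensor_tmul, TensorProduct.map_tmul, LinearEquiv.coe_coe,
      TensorProduct.assoc_tmul, TensorProduct.comm_tmul, LinearMap.id_apply]
    induction comul (R := R) a with
    | zero => simp
    | add x y hx hy => simp only [map_add, TensorProduct.tmul_add, TensorProduct.add_tmul, hx, hy]
    | tmul x y => simp [← TensorProduct.smul_tmul', smul_smul, mul_comm]
  rw [Qmap, h4]
  exact congr($key ∘ₗ comul3 R H)

lemma Stw_eq_comp (γ γ' : H ⊗[R] H →ₗ[R] R) (u v : Cop H →ₗ[R] R)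
    (hu : uMap R H γ = u) (hv : ubarMap R H γ' = v) :
    Stw R H γ γ' = (antipodeCoalgHom R H).toLinearMap ∘ₗ scalarRight u ∘ₗ scalarLeft v := by
  subst hu hv
  have key : (TensorProduct.lid R H).toLinearMap ∘ₗ (TensorProduct.rid R (R ⊗[R] H)).toLinearMap
      ∘ₗ TensorProduct.map (TensorProduct.map (uMap R H γ) (Sa R H)) (ubarMap R H γ')
      ∘ₗ TensorProduct.map comul LinearMap.id =
      Sa R H ∘ₗ ((TensorProduct.rid R H).toLinearMap
        ∘ₗ LinearMap.lTensor H (uMap R H γ) ∘ₗ (TensorProduct.comm R H H).toLinearMap ∘ₗ comul)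
        ∘ₗ (TensorProduct.lid R H).toLinearMap ∘ₗ LinearMap.rTensor H (ubarMap R H γ')
        ∘ₗ (TensorProduct.comm R H H).toLinearMap := by
    ext a b
    simp only [TensorProduct.AlgebraTensorModule.curry_apply, TensorProduct.curry_apply,
      LinearMap.restrictScalars_self, LinearMap.comp_apply, LinearMap.rTensor_tmul,
      TensorProduct.map_tmul, LinearEquiv.coe_coe, TensorProduct.lid_tmul, map_smul,
      TensorProduct.comm_tmul, LinearMap.id_apply]
    induction comul (R := R) a with
    | zero => simp
    | add x y hx hy => simp only [map_add, TensorProduct.add_tmul, hx, hy, smul_add]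
    | tmul x y => simp
  exact congr($key ∘ₗ comul)

lemma twistMul_eq_convMul (γ γ' : H ⊗[R] H →ₗ[R] R) :
    twistMul R H (mulH R H) γ γ' =
      (convScalar H γ * toConv (mulH R H) * convScalar H γ').ofConv := by
  refine LinearMap.ext fun z => ?_
  simp only [twistMul, LinearMap.comp_apply, LinearMap.convMul_apply]
  change _ = LinearMap.mul' R H (TensorProduct.map _ _ (comul2 R H z))
  induction comul2 R H z with
  | zero => simp
  | add x y hx hy => simp only [map_add, hx, hy]
  | tmul p q =>
    simp only [TensorProduct.map_tmul, LinearMap.convMul_apply]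
    change _ = LinearMap.mul' R H ((LinearMap.mul' R H (TensorProduct.map _ _ (comul2 R H p))) ⊗ₜ _)
    induction comul2 R H p with
    | zero => simp
    | add x y hx hy => simp only [map_add, TensorProduct.add_tmul, hx, hy]
    | tmul r s =>
      simp [convScalar, ← Algebra.smul_def, ← Algebra.commutes, smul_smul, mul_comm]

end Intertwining

/-- `Q` intertwines the twisted adjoint coaction
`Ad_γ(h) = h₍₂₎ ⊗ S_γ(h₍₁₎) ·_γ h₍₃₎` with the undeformed adjoint coaction
`Ad(h) = h₍₂₎ ⊗ S(h₍₁₎)h₍₃₎`: `(Q ⊗ id) ∘ Ad_γ = Ad ∘ Q`. -/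
theorem Qmap_intertwines (R H : Type*) [CommRing R] [Ring H] [HopfAlgebra R H]
    (hS : Function.Bijective (Sa R H))
    (γ γ' : H ⊗[R] H →ₗ[R] R) (hco : IsCocycle R H (mulH R H) γ γ') :
    map (Qmap R H γ γ') LinearMap.id
        ∘ₗ AdGen R H (Stw R H γ γ') (twistMul R H (mulH R H) γ γ')
      = Ad R H ∘ₗ Qmap R H γ γ' := by
  let u : Cop H →ₗ[R] R := uMap R H γ
  let v : Cop H →ₗ[R] R := ubarMap R H γ'
  let φ : Cop H ⊗[R] H →ₗc[R] H ⊗[R] H :=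
    Coalgebra.TensorProduct.map (antipodeCoalgHom R H) (CoalgHom.id R H)
  let G := γ ∘ₗ φ.toLinearMap
  let G' := γ' ∘ₗ φ.toLinearMap
  let q := G' ∘ₗ LinearMap.rTensor H (scalarRight u)
  let m : WithConv (Cop H ⊗[R] H →ₗ[R] H) := toConv (mulH R H ∘ₗ φ.toLinearMap)
  have hvu : toConv u * toConv v = 1 := by
    have key : LinearMap.mul' R R ∘ₗ TensorProduct.map (uMap R H γ) (ubarMap R H γ') ∘ₗ
        (TensorProduct.comm R H H).toLinearMap =
        LinearMap.mul' R R ∘ₗ TensorProduct.map (ubarMap R H γ') (uMap R H γ) := by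
      ext x y
      simp [mul_comm]
    refine WithConv.ofConv_injective ?_
    exact congr($key ∘ₗ comul).trans congr(WithConv.ofConv $(ubarMap_mul_uMap hco))
  have huv : convScalar H (fstScalar H u) * convScalar H (fstScalar H v) = 1 := by
    rw [convScalar_mul, fstScalar_mul, hvu]
    exact congr(convScalar H (WithConv.ofConv $(fstScalar_counit (R := R) (C := Cop H) (D := H))))
  have hG : convScalar H G' * convScalar H G = 1 := by
    have h := LinearMap.convMul_comp_coalgHom_distrib (toConv γ') (toConv γ) φ
    rw [hco.convMul_eq_one] at h
    rw [convScalar_mul]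
    exact congr(convScalar H $(h.symm.trans congr(Algebra.linearMap R R ∘ₗ $(φ.counit_comp))))
  have hq : convScalar H q = convScalar H G' * convScalar H (fstScalar H u) := by
    rw [mul_convScalar_fstScalar]
    rfl
  have hT : toConv (twistMul R H (mulH R H) γ γ' ∘ₗ LinearMap.rTensor H
        ((antipodeCoalgHom R H).toLinearMap ∘ₗ scalarRight u ∘ₗ scalarLeft v)) =
      convScalar H (fstScalar H v) * (convScalar H G * m * convScalar H G' *
        convScalar H (fstScalar H u)) := by
    have h1 : toConv (twistMul R H (mulH R H) γ γ' ∘ₗ φ.toLinearMap) =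
        convScalar H G * m * convScalar H G' := by
      rw [twistMul_eq_convMul, LinearMap.convMul_comp_coalgHom_distrib,
        LinearMap.convMul_comp_coalgHom_distrib]
      rfl
    rw [← h1, mul_convScalar_fstScalar, convScalar_fstScalar_mul]
    rw [LinearMap.rTensor_comp, LinearMap.rTensor_comp]
    rfl
  have hQ : Qmap R H γ γ' = sandwichScalar q := Qmap_eq_sandwichScalar γ γ' u rfl
  rw [Ad, AdGen_eq_sandwichWith _ _ (Stw_eq_comp γ γ' u v rfl rfl),
    AdGen_eq_sandwichWith (Sa R H) (antipodeCoalgHom R H).toLinearMap rfl, hQ,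
    sandwichWith_comp_sandwichScalar, hT]
  refine (rTensor_sandwichScalar_comp_sandwichWith _ _).trans ?_
  congr 1
  change _ = m * _
  calc
    _ = convScalar H G' * (convScalar H (fstScalar H u) * convScalar H (fstScalar H v)) *
        convScalar H G * m * (convScalar H G' * convScalar H (fstScalar H u)) := by
      rw [hq]; simp only [mul_assoc]
    _ = _ := by rw [huv, mul_one, hG, one_mul, hq]
end

section
/- Let H be a Hopf algebra, A a right H-comodule algebra with B = A^{coH}, and γ a 2-cocycle on H. Then the following diagram commutes: (id ⊗ Q) followed by φ_{A,H} applied to the twisted canonical map χ_γ equals the original canonical map χ precomposed with φ_{A,A}; explicitly, for all a, a' ∈ A, φ_{A,H}((id ⊗ Q)(χ_γ(a ⊗ a'))) = χ(φ_{A,A}(a ⊗ a')), where χ_γ(a⊗a') = (a •_γ a'₍₀₎) ⊗ a'₍₁₎, φ_{A,A}(a⊗a') = a₍₀₎⊗a'₍₀₎ γ̄(a₍₁₎⊗a'₍₁₎), φ_{A,H}(a⊗h) = a₍₀₎⊗h₍₂₎ γ̄(a₍₁₎⊗S(h₍₁₎)h₍₃₎), and Q(h) = h₍₃₎ u_γ(h₍₁₎)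 γ̄(S(h₍₂₎)⊗h₍₄₎). -/
open TensorProduct LinearMap

noncomputable section

open TensorProduct LinearMap

variable (R H A : Type*) [CommRing R] [Ring H] [HopfAlgebra R H]
  [Ring A] [Algebra R A]

/-- The diagonal `H`-coaction on `A ⊗ A`: `a ⊗ a' ↦ a₍₀₎ ⊗ a'₍₀₎ ⊗ a₍₁₎a'₍₁₎`. -/
def coactAA (δ : A →ₗ[R] A ⊗[R] H) : A ⊗[R] A →ₗ[R] (A ⊗[R] A) ⊗[R] H :=
  map LinearMap.id (mulH R H) ∘ₗ (tensorTensorTensorComm R A H A H).toLinearMap ∘ₗ map δ δ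

/-- The canonical map `a ⊗ a' ↦ a ∙ a'₍₀₎ ⊗ a'₍₁₎` (with respect to a product `μA` on `A`). -/
def chiMap (μA : A ⊗[R] A →ₗ[R] A) (δ : A →ₗ[R] A ⊗[R] H) : A ⊗[R] A →ₗ[R] A ⊗[R] H :=
  map μA LinearMap.id ∘ₗ (TensorProduct.assoc R A A H).symm.toLinearMap ∘ₗ map LinearMap.id δ

/-- The `H`-coaction on `A ⊗ H̲`: `a ⊗ h ↦ a₍₀₎ ⊗ h₍₂₎ ⊗ a₍₁₎ S(h₍₁₎) h₍₃₎`. -/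
def coactAH (δ : A →ₗ[R] A ⊗[R] H) : A ⊗[R] H →ₗ[R] (A ⊗[R] H) ⊗[R] H :=
  map LinearMap.id (mulH R H) ∘ₗ (tensorTensorTensorComm R A H H H).toLinearMap ∘ₗ map δ (Ad R H)

/-- `δ` is a coassociative counital coaction. -/
def IsCoaction {V : Type*} [AddCommGroup V] [Module R V] (δ : V →ₗ[R] V ⊗[R] H) : Prop :=
  ((TensorProduct.assoc R V H H).toLinearMap ∘ₗ map δ LinearMap.id ∘ₗ δ
      = map LinearMap.id (Coalgebra.comul (R := R)) ∘ₗ δ) ∧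
  ((TensorProduct.rid R V).toLinearMap ∘ₗ map LinearMap.id (Coalgebra.counit (R := R)) ∘ₗ δ
      = LinearMap.id)

/-- `δ` makes `A` a right `H`-comodule algebra. -/
def IsComodAlg (δ : A →ₗ[R] A ⊗[R] H) : Prop :=
  IsCoaction R H δ ∧ (∀ a b : A, δ (a * b) = δ a * δ b) ∧ δ 1 = 1

/-- The twist-deformed product `a •_γ a' = a₍₀₎ a'₍₀₎ γ'(a₍₁₎ ⊗ a'₍₁₎)` on `A`. -/
def mulAg (δ : A →ₗ[R] A ⊗[R] H) (γ' : H ⊗[R] H →ₗ[R] R) : A ⊗[R] A →ₗ[R] A :=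
  (TensorProduct.rid R A).toLinearMap ∘ₗ map (LinearMap.mul' R A) γ'
    ∘ₗ (tensorTensorTensorComm R A H A H).toLinearMap ∘ₗ map δ δ

end

/-- The map `φ(v ⊗ w) = v₍₀₎ ⊗ w₍₀₎ γ'(v₍₁₎ ⊗ w₍₁₎)` for right `H`-comodules `V`, `W`. -/
noncomputable def phiMap (R H : Type*) [CommRing R] [Ring H] [HopfAlgebra R H]
    (V W : Type*) [AddCommGroup V] [Module R V] [AddCommGroup W] [Module R W]
    (δV : V →ₗ[R] V ⊗[R] H) (δW : W →ₗ[R] W ⊗[R] H) (γ' : H ⊗[R] H →ₗ[R] R) :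
    V ⊗[R] W →ₗ[R] V ⊗[R] W :=
  (TensorProduct.rid R (V ⊗[R] W)).toLinearMap ∘ₗ map LinearMap.id γ'
    ∘ₗ (tensorTensorTensorComm R V H W H).toLinearMap ∘ₗ map δV δW

/-- `δ` is a coassociative counital right coaction. -/
def IsCoactionOn (R H : Type*) [CommRing R] [Ring H] [HopfAlgebra R H]
    {V : Type*} [AddCommGroup V] [Module R V] (δV : V →ₗ[R] V ⊗[R] H) : Prop :=
  ((TensorProduct.assoc R V H H).toLinearMap ∘ₗ map δV LinearMap.id ∘ₗ δV
      = map LinearMap.id (Coalgebra.comul (R := R)) ∘ₗ δV) ∧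
  ((TensorProduct.rid R V).toLinearMap ∘ₗ map LinearMap.id (Coalgebra.counit (R := R)) ∘ₗ δV
      = LinearMap.id)

/-- The diagonal coaction on `V ⊗ W`, with the `H`-legs combined by a product `μ`. -/
noncomputable def coactDiag (R H : Type*) [CommRing R] [Ring H] [HopfAlgebra R H]
    (V W : Type*) [AddCommGroup V] [Module R V] [AddCommGroup W] [Module R W]
    (δV : V →ₗ[R] V ⊗[R] H) (δW : W →ₗ[R] W ⊗[R] H) (μ : H ⊗[R] H →ₗ[R] H) :
    V ⊗[R] W →ₗ[R] (V ⊗[R] W) ⊗[R] H :=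
  map LinearMap.id μ ∘ₗ (tensorTensorTensorComm R V H W H).toLinearMap ∘ₗ map δV δW

open Coalgebra WithConv

section Coaction

variable {R V W C D : Type*} [CommRing R] [AddCommGroup V] [Module R V] [AddCommGroup W]
  [Module R W] [AddCommGroup C] [Module R C] [Coalgebra R C] [AddCommGroup D] [Module R D]
  [Coalgebra R D]

/-- Coassociativity of a right coaction of a coalgebra. -/
def IsCoassoc (δ : V →ₗ[R] V ⊗[R] C) : Prop :=
  (TensorProduct.assoc R V C C).toLinearMap ∘ₗ map δ LinearMap.id ∘ₗ δ =
    map LinearMap.id (comul (R := R)) ∘ₗ δ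

/-- The action `v ↦ v₍₀₎ f(v₍₁₎)` of a functional `f` on a comodule. -/
noncomputable def coact (δ : V →ₗ[R] V ⊗[R] C) (f : C →ₗ[R] R) : V →ₗ[R] V :=
  (TensorProduct.rid R V).toLinearMap ∘ₗ map LinearMap.id f ∘ₗ δ

/-- The coaction of `C ⊗ D` on the tensor product of a `C`-comodule and a `D`-comodule. -/
noncomputable def tensorCoaction (δV : V →ₗ[R] V ⊗[R] C) (δW : W →ₗ[R] W ⊗[R] D) :
    V ⊗[R] W →ₗ[R] (V ⊗[R] W) ⊗[R] (C ⊗[R] D) :=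
  (tensorTensorTensorComm R V C W D).toLinearMap ∘ₗ map δV δW

theorem IsCoassoc.coact_comp_coact {δ : V →ₗ[R] V ⊗[R] C} (hδ : IsCoassoc δ)
    (f g : WithConv (C →ₗ[R] R)) :
    coact δ f.ofConv ∘ₗ coact δ g.ofConv = coact δ (f * g).ofConv := by
  have h1 : coact δ f.ofConv ∘ₗ coact δ g.ofConv =
      ((TensorProduct.rid R V).toLinearMap ∘ₗ
        map LinearMap.id (LinearMap.mul' R R ∘ₗ map f.ofConv g.ofConv)) ∘ₗ
      ((TensorProduct.assoc R V C C).toLinearMap ∘ₗ map δ LinearMap.id ∘ₗ δ) := by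
    ext v
    simp only [coact, LinearMap.comp_apply]
    induction δ v using TensorProduct.induction_on with
    | zero => simp
    | add x y hx hy => simp only [map_add, hx, hy]
    | tmul x c =>
      simp only [LinearEquiv.coe_coe, map_tmul, rid_tmul, map_smul, id_apply]
      induction δ x using TensorProduct.induction_on with
      | zero => simp
      | add x y hx hy => simp only [map_add, hx, hy, add_tmul, smul_add]
      | tmul x d => simp [smul_smul, mul_comm]
  rw [h1, hδ]
  ext v
  simp only [coact, LinearMap.comp_apply]
  induction δ v using TensorProduct.induction_on with
  | zero => simp
  | add x y hx hy => simp only [map_add, hx, hy]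
  | tmul x c => simp [LinearMap.convMul_def]

theorem IsCoassoc.tensor {δV : V →ₗ[R] V ⊗[R] C} {δW : W →ₗ[R] W ⊗[R] D}
    (hV : IsCoassoc δV) (hW : IsCoassoc δW) : IsCoassoc (tensorCoaction δV δW) := by
  let s : (V ⊗[R] (C ⊗[R] C)) ⊗[R] (W ⊗[R] (D ⊗[R] D)) →ₗ[R]
      (V ⊗[R] W) ⊗[R] ((C ⊗[R] D) ⊗[R] (C ⊗[R] D)) :=
    map LinearMap.id (tensorTensorTensorComm R C C D D).toLinearMap ∘ₗ
      (tensorTensorTensorComm R V (C ⊗[R] C) W (D ⊗[R] D)).toLinearMap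
  have h1 : (TensorProduct.assoc R (V ⊗[R] W) (C ⊗[R] D) (C ⊗[R] D)).toLinearMap ∘ₗ
      map (tensorCoaction δV δW) LinearMap.id ∘ₗ tensorCoaction δV δW =
      s ∘ₗ map ((TensorProduct.assoc R V C C).toLinearMap ∘ₗ map δV LinearMap.id ∘ₗ δV)
        ((TensorProduct.assoc R W D D).toLinearMap ∘ₗ map δW LinearMap.id ∘ₗ δW) := by
    ext v w
    simp only [tensorCoaction, AlgebraTensorModule.curry_apply, curry_apply,
      LinearMap.coe_restrictScalars, LinearMap.comp_apply, map_tmul]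
    induction δV v using TensorProduct.induction_on with
    | zero => simp
    | add x y hx hy => simp only [map_add, hx, hy, add_tmul]
    | tmul x c =>
      induction δW w using TensorProduct.induction_on with
      | zero => simp
      | add x y hx hy => simp only [map_add, hx, hy, tmul_add]
      | tmul y d =>
        simp only [LinearEquiv.coe_coe, map_tmul, tensorTensorTensorComm_tmul, id_apply,
          LinearMap.comp_apply]
        induction δV x using TensorProduct.induction_on with
        | zero => simp
        | add x y hx hy => simp only [map_add, hx, hy, add_tmul]
        | tmul x c =>
          induction δW y using TensorProduct.induction_on with
          | zero => simp
          | add x y hx hy => simp only [map_add, hx, hy, tmul_add, add_tmul]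
          | tmul y d => simp [s]
  rw [IsCoassoc, h1, hV, hW]
  ext v w
  simp only [tensorCoaction, AlgebraTensorModule.curry_apply, curry_apply,
    LinearMap.coe_restrictScalars, LinearMap.comp_apply, map_tmul]
  induction δV v using TensorProduct.induction_on with
  | zero => simp
  | add x y hx hy => simp only [map_add, hx, hy, add_tmul]
  | tmul x c =>
    induction δW w using TensorProduct.induction_on with
    | zero => simp
    | add x y hx hy => simp only [map_add, hx, hy, tmul_add]
    | tmul y d =>
      simp [s, TensorProduct.comul_def, AlgebraTensorModule.tensorTensorTensorComm_eq,
        AlgebraTensorModule.map_eq]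

end Coaction

section Adjoint

variable (R H : Type*) [CommRing R] [Ring H] [HopfAlgebra R H]

open HopfAlgebra

theorem comul_comp_antipode :
    comul (R := R) ∘ₗ Sa R H =
      (TensorProduct.comm R H H).toLinearMap ∘ₗ map (Sa R H) (Sa R H) ∘ₗ comul (R := R) := by
  let i : H →ₐ[R] H ⊗[R] H := Algebra.TensorProduct.includeLeft
  let j : H →ₐ[R] H ⊗[R] H := Algebra.TensorProduct.includeRight
  have comp_mul (k : H →ₐ[R] H ⊗[R] H) (f g : H →ₗ[R] H) :
      toConv (k.toLinearMap ∘ₗ f) * toConv (k.toLinearMap ∘ₗ g) =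
        toConv (k.toLinearMap ∘ₗ (toConv f * toConv g).ofConv) := by
    rw [LinearMap.algHom_comp_convMul_distrib]
  have comp_one (k : H →ₐ[R] H ⊗[R] H) :
      toConv (k.toLinearMap ∘ₗ (1 : WithConv (H →ₗ[R] H)).ofConv) = 1 := by
    ext h; simp [LinearMap.convOne_def]
  have inv_l : toConv (comul (R := R) ∘ₗ Sa R H) * toConv (comul (R := R) (A := H)) = 1 := by
    have := comp_mul (Bialgebra.comulAlgHom R H) (Sa R H) LinearMap.id
    rw [antipode_mul_id, comp_one] at this
    exact this
  have e1 : toConv (comul (R := R) (A := H)) =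
      toConv (i.toLinearMap ∘ₗ LinearMap.id) * toConv (j.toLinearMap ∘ₗ LinearMap.id) := by
    ext h
    simp [(ℛ R h).convMul_apply, i, j, (ℛ R h).eq]
  have e2 : toConv ((TensorProduct.comm R H H).toLinearMap ∘ₗ map (Sa R H) (Sa R H) ∘ₗ
      comul (R := R)) =
      toConv (j.toLinearMap ∘ₗ Sa R H) * toConv (i.toLinearMap ∘ₗ Sa R H) := by
    ext h
    simp [(ℛ R h).convMul_apply, i, j]
    simp [← (ℛ R h).eq]
  have inv_r : toConv (comul (R := R) (A := H)) *
      toConv ((TensorProduct.comm R H H).toLinearMap ∘ₗ map (Sa R H) (Sa R H) ∘ₗ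
        comul (R := R)) = 1 := by
    rw [e1, e2, mul_assoc, ← mul_assoc (toConv (j.toLinearMap ∘ₗ LinearMap.id)), comp_mul,
      id_mul_antipode, comp_one, one_mul, comp_mul, id_mul_antipode, comp_one]
  exact toConv_injective (left_inv_eq_right_inv inv_l inv_r)

/-- The coaction `h ↦ h₍₂₎ ⊗ (S(h₍₁₎) ⊗ h₍₃₎)` of `H ⊗ H` on `H`. -/
noncomputable def biAdjoint : H →ₗ[R] H ⊗[R] (H ⊗[R] H) :=
  (TensorProduct.assoc R H H H).toLinearMap ∘ₗ
    map ((TensorProduct.comm R H H).toLinearMap ∘ₗ map (Sa R H) LinearMap.id) LinearMap.id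
    ∘ₗ comul3 R H

theorem isCoassoc_biAdjoint : IsCoassoc (biAdjoint R H) := by
  let G : ((H ⊗[R] H) ⊗[R] H) ⊗[R] (H ⊗[R] H) →ₗ[R] H ⊗[R] ((H ⊗[R] H) ⊗[R] (H ⊗[R] H)) :=
    map LinearMap.id ((tensorTensorTensorComm R H H H H).toLinearMap ∘ₗ
      map ((TensorProduct.comm R H H).toLinearMap ∘ₗ map (Sa R H) (Sa R H)) LinearMap.id) ∘ₗ
    (TensorProduct.assoc R H (H ⊗[R] H) (H ⊗[R] H)).toLinearMap ∘ₗ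
    map (TensorProduct.comm R (H ⊗[R] H) H).toLinearMap LinearMap.id
  let e : (H ⊗[R] ((H ⊗[R] H) ⊗[R] H)) ⊗[R] H →ₗ[R] ((H ⊗[R] H) ⊗[R] H) ⊗[R] (H ⊗[R] H) :=
    (TensorProduct.assoc R ((H ⊗[R] H) ⊗[R] H) H H).toLinearMap ∘ₗ
    map (map (TensorProduct.assoc R H H H).symm.toLinearMap LinearMap.id ∘ₗ
      (TensorProduct.assoc R H (H ⊗[R] H) H).symm.toLinearMap) LinearMap.id
  have hcoassoc : e ∘ₗ map (map LinearMap.id (comul3 R H)) LinearMap.id ∘ₗ comul3 R H =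
      map (map (comul (R := R)) LinearMap.id) (comul (R := R)) ∘ₗ comul3 R H := by
    simp only [e, comul3, coassoc_simps]
  have hl : (TensorProduct.assoc R H (H ⊗[R] H) (H ⊗[R] H)).toLinearMap ∘ₗ
      map (biAdjoint R H) LinearMap.id ∘ₗ biAdjoint R H =
      G ∘ₗ e ∘ₗ map (map LinearMap.id (comul3 R H)) LinearMap.id ∘ₗ comul3 R H := by
    ext h
    simp only [biAdjoint, LinearMap.comp_apply]
    induction comul3 R H h using TensorProduct.induction_on with
    | zero => simp
    | add x y hx hy => simp only [map_add, hx, hy]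
    | tmul x l =>
      induction x using TensorProduct.induction_on with
      | zero => simp
      | add x y hx hy => simp only [map_add, add_tmul, hx, hy]
      | tmul p x =>
        simp only [LinearEquiv.coe_coe, map_tmul, comm_tmul, assoc_tmul, id_apply,
          LinearMap.comp_apply]
        induction comul3 R H x using TensorProduct.induction_on with
        | zero => simp
        | add x y hx hy => simp only [map_add, add_tmul, tmul_add, hx, hy]
        | tmul x k =>
          induction x using TensorProduct.induction_on with
          | zero => simp
          | add x y hx hy => simp only [map_add, add_tmul, tmul_add, hx, hy]
          | tmul q m => simp [G, e]
  have hr : map LinearMap.id (comul (R := R)) ∘ₗ biAdjoint R H =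
      G ∘ₗ map (map (comul (R := R)) LinearMap.id) (comul (R := R)) ∘ₗ comul3 R H := by
    ext h
    simp only [biAdjoint, LinearMap.comp_apply]
    induction comul3 R H h using TensorProduct.induction_on with
    | zero => simp
    | add x y hx hy => simp only [map_add, hx, hy]
    | tmul x l =>
      induction x using TensorProduct.induction_on with
      | zero => simp
      | add x y hx hy => simp only [map_add, add_tmul, hx, hy]
      | tmul p x =>
        have hp := LinearMap.congr_fun (comul_comp_antipode R H) p
        simp only [LinearMap.comp_apply] at hp
        simp [G, TensorProduct.comul_def, AlgebraTensorModule.tensorTensorTensorComm_eq,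
          AlgebraTensorModule.map_eq, hp]
  rw [IsCoassoc, hl, hcoassoc, hr]

theorem coact_biAdjoint_counit :
    coact (biAdjoint R H) (counit (R := R)) = LinearMap.id := by
  have h1 : coact (biAdjoint R H) (counit (R := R)) =
      (TensorProduct.rid R H).toLinearMap ∘ₗ
        map ((TensorProduct.lid R H).toLinearMap ∘ₗ
          map (counit (R := R)) LinearMap.id ∘ₗ comul (R := R)) (counit (R := R)) ∘ₗ
        comul (R := R) := by
    ext h
    simp only [coact, biAdjoint, comul3, LinearMap.comp_apply]
    induction comul (R := R) h using TensorProduct.induction_on with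
    | zero => simp
    | add x y hx hy => simp only [map_add, hx, hy]
    | tmul x l =>
      simp only [LinearEquiv.coe_coe, map_tmul, id_apply, LinearMap.comp_apply]
      induction comul (R := R) x using TensorProduct.induction_on with
      | zero => simp
      | add x y hx hy => simp only [map_add, add_tmul, hx, hy]
      | tmul p x => simp [TensorProduct.counit_def, smul_smul]
  rw [h1]
  ext h
  have hl : (TensorProduct.lid R H).toLinearMap ∘ₗ
      map (counit (R := R)) LinearMap.id ∘ₗ comul (R := R) = LinearMap.id (M := H) := by
    ext h
    have := Coalgebra.rTensor_counit_comul (R := R) h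
    rw [LinearMap.rTensor] at this
    simp [this]
  have := Coalgebra.lTensor_counit_comul (R := R) h
  rw [LinearMap.lTensor] at this
  rw [hl]
  simp [this]

/-- The map `h ↦ h₍₃₎ ⊗ (h₍₁₎ ⊗ (S(h₍₂₎) ⊗ h₍₄₎))`. -/
noncomputable def leftBiAdjoint : H →ₗ[R] H ⊗[R] (H ⊗[R] (H ⊗[R] H)) :=
  (TensorProduct.leftComm R H H (H ⊗[R] H)).toLinearMap ∘ₗ
    map LinearMap.id (biAdjoint R H) ∘ₗ comul (R := R)

/-- Two adjacent legs of an iterated comultiplication can be contracted by a bilinear map. -/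
theorem leftBiAdjoint_contract {M : Type*} [AddCommGroup M] [Module R M]
    (f : H ⊗[R] H →ₗ[R] M) :
    map LinearMap.id (map f LinearMap.id ∘ₗ
      (TensorProduct.assoc R H H H).symm.toLinearMap) ∘ₗ leftBiAdjoint R H =
    (TensorProduct.leftComm R M H H).toLinearMap ∘ₗ
      map (f ∘ₗ map LinearMap.id (Sa R H) ∘ₗ comul (R := R)) (comul (R := R)) ∘ₗ
        comul (R := R) := by
  let G : (H ⊗[R] H) ⊗[R] (H ⊗[R] H) →ₗ[R] H ⊗[R] (M ⊗[R] H) :=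
    (TensorProduct.leftComm R M H H).toLinearMap ∘ₗ
      map (f ∘ₗ map LinearMap.id (Sa R H)) LinearMap.id
  let e : H ⊗[R] ((H ⊗[R] H) ⊗[R] H) →ₗ[R] (H ⊗[R] H) ⊗[R] (H ⊗[R] H) :=
    (TensorProduct.assoc R (H ⊗[R] H) H H).toLinearMap ∘ₗ
    map (TensorProduct.assoc R H H H).symm.toLinearMap LinearMap.id ∘ₗ
      (TensorProduct.assoc R H (H ⊗[R] H) H).symm.toLinearMap
  have hcoassoc : e ∘ₗ map LinearMap.id (comul3 R H) ∘ₗ comul (R := R) =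
      map (comul (R := R)) (comul (R := R)) ∘ₗ comul (R := R) := by
    simp only [e, comul3, coassoc_simps]
  have hl : map LinearMap.id (map f LinearMap.id ∘ₗ
      (TensorProduct.assoc R H H H).symm.toLinearMap) ∘ₗ leftBiAdjoint R H =
      G ∘ₗ e ∘ₗ map LinearMap.id (comul3 R H) ∘ₗ comul (R := R) := by
    ext h
    simp only [biAdjoint, leftBiAdjoint, LinearMap.comp_apply]
    induction comul (R := R) h using TensorProduct.induction_on with
    | zero => simp
    | add x y hx hy => simp only [map_add, hx, hy]
    | tmul x l =>
      simp only [map_tmul, id_apply, LinearMap.comp_apply]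
      induction comul3 R H l using TensorProduct.induction_on with
      | zero => simp
      | add x y hx hy => simp only [map_add, tmul_add, hx, hy]
      | tmul y k =>
        induction y using TensorProduct.induction_on with
        | zero => simp
        | add x y hx hy => simp only [map_add, add_tmul, tmul_add, hx, hy]
        | tmul q m => simp [G, e]
  rw [hl, hcoassoc]
  simp only [G, LinearMap.comp_assoc]
  simp only [← LinearMap.comp_assoc, ← map_comp, LinearMap.id_comp]

end Adjoint
section Cocycle

variable {R H : Type*} [CommRing R] [Ring H] [HopfAlgebra R H]

/-- Pullback of convolution algebras along a coalgebra morphism. -/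
def convPullback {C D : Type*} [AddCommGroup C] [Module R C] [Coalgebra R C] [AddCommGroup D]
    [Module R D] [Coalgebra R D] (q : D →ₗc[R] C) :
    WithConv (C →ₗ[R] R) →* WithConv (D →ₗ[R] R) where
  toFun f := toConv (f.ofConv ∘ₗ q.toLinearMap)
  map_one' := by ext d; simp [LinearMap.convOne_def]
  map_mul' f g := congrArg toConv (LinearMap.convMul_comp_coalgHom_distrib f g q)

theorem toConv_mul'_map_mul {C D : Type*} [AddCommGroup C] [Module R C] [Coalgebra R C]
    [AddCommGroup D] [Module R D] [Coalgebra R D] (f h : WithConv (C →ₗ[R] R))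
    (g k : WithConv (D →ₗ[R] R)) :
    toConv (LinearMap.mul' R R ∘ₗ map f.ofConv g.ofConv) *
      toConv (LinearMap.mul' R R ∘ₗ map h.ofConv k.ofConv) =
    toConv (LinearMap.mul' R R ∘ₗ map (f * h).ofConv (g * k).ofConv) := by
  have h1 := LinearMap.algHom_comp_convMul_distrib (Algebra.TensorProduct.lmul' R (S := R))
    (toConv (map f.ofConv g.ofConv)) (toConv (map h.ofConv k.ofConv))
  rw [TensorProduct.map_convMul_map] at h1
  exact congrArg toConv h1.symm

variable (R H) in
/-- The map `x ⊗ (y ⊗ k) ↦ xy ⊗ k`. -/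
noncomputable def mulLeft₂ : H ⊗[R] (H ⊗[R] H) →ₗ[R] H ⊗[R] H :=
  map (mulH R H) LinearMap.id ∘ₗ (TensorProduct.assoc R H H H).symm.toLinearMap

variable (R H) in
/-- The map `g ⊗ (x ⊗ w) ↦ gx ⊗ w`. -/
noncomputable def mulLeft₃ :
    H ⊗[R] (H ⊗[R] (H ⊗[R] H)) →ₗ[R] H ⊗[R] (H ⊗[R] H) :=
  map (mulH R H) LinearMap.id ∘ₗ (TensorProduct.assoc R H H (H ⊗[R] H)).symm.toLinearMap

/-- The functional `g ⊗ z ↦ ε(g) f(z)`. -/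
noncomputable def counitLeft {C D : Type*} [AddCommGroup C] [Module R C] [Coalgebra R C]
    [AddCommGroup D] [Module R D] (f : D →ₗ[R] R) : C ⊗[R] D →ₗ[R] R :=
  (TensorProduct.lid R R).toLinearMap ∘ₗ map (counit (R := R)) f

/-- The functional `x ⊗ (y ⊗ z) ↦ f(x ⊗ y) ε(z)`. -/
noncomputable def counitRight {C D : Type*} [AddCommGroup C] [Module R C]
    [AddCommGroup D] [Module R D] [Coalgebra R D] (f : C ⊗[R] C →ₗ[R] R) :
    C ⊗[R] (C ⊗[R] D) →ₗ[R] R :=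
  (TensorProduct.lid R R).toLinearMap ∘ₗ map f (counit (R := R)) ∘ₗ
    (TensorProduct.assoc R C C D).symm.toLinearMap

theorem IsCocycle.convMul_inverse {γ γ' : H ⊗[R] H →ₗ[R] R}
    (hco : IsCocycle R H (mulH R H) γ γ') :
    toConv γ * toConv γ' = 1 ∧ toConv γ' * toConv γ = 1 := by
  have h1 : toConv (counit2 R H) = 1 := by
    ext x y
    simp [counit2, LinearMap.convOne_def, TensorProduct.counit_def, mul_comm]
  exact ⟨(congrArg toConv hco.conv_inv_right).trans h1, (congrArg toConv hco.conv_inv_left).trans h1⟩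

theorem IsCocycle.inverse_one_tmul {γ γ' : H ⊗[R] H →ₗ[R] R}
    (hco : IsCocycle R H (mulH R H) γ γ') (h : H) : γ' (1 ⊗ₜ[R] h) = counit (R := R) h := by
  have h1 := LinearMap.congr_fun hco.conv_inv_right (1 ⊗ₜ[R] h)
  have h2 : ∀ t : H ⊗[R] H, LinearMap.mul' R R (map γ γ' (tensorTensorTensorComm R H H H H
      ((1 ⊗ₜ[R] 1) ⊗ₜ[R] t))) =
      γ' (1 ⊗ₜ[R] (TensorProduct.lid R H (map (counit (R := R)) LinearMap.id t))) := by
    intro t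
    induction t using TensorProduct.induction_on with
    | zero => simp
    | add x y hx hy => simp only [map_add, tmul_add, hx, hy]
    | tmul x y => simp [hco.unital_left]
  have h3 := Coalgebra.rTensor_counit_comul (R := R) h
  rw [LinearMap.rTensor] at h3
  simp only [convOn, comul2, LinearMap.comp_apply, map_tmul, LinearEquiv.coe_coe,
    Bialgebra.comul_one, Algebra.TensorProduct.one_def, h2, h3] at h1
  simpa [counit2] using h1

/-- The 2-cocycle identity for the convolution inverse. -/
theorem IsCocycle.inverse_cocycle {γ γ' : H ⊗[R] H →ₗ[R] R}
    (hco : IsCocycle R H (mulH R H) γ γ') :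
    toConv (γ' ∘ₗ map (mulH R H) LinearMap.id) *
      toConv (LinearMap.mul' R R ∘ₗ map γ' (counit (R := R))) =
    toConv (γ' ∘ₗ map LinearMap.id (mulH R H) ∘ₗ (TensorProduct.assoc R H H H).toLinearMap) *
      toConv (LinearMap.mul' R R ∘ₗ map (counit (R := R)) γ' ∘ₗ
        (TensorProduct.assoc R H H H).toLinearMap) := by
  let p12 : (H ⊗[R] H) ⊗[R] H →ₗc[R] H ⊗[R] H :=
    (Coalgebra.TensorProduct.rid R R (H ⊗[R] H)).toCoalgHom.comp
      (Coalgebra.TensorProduct.map (.id R _) (Coalgebra.counitCoalgHom R H))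
  let pm : (H ⊗[R] H) ⊗[R] H →ₗc[R] H ⊗[R] H :=
    Coalgebra.TensorProduct.map (Bialgebra.mulCoalgHom R H) (.id R _)
  let p23 : (H ⊗[R] H) ⊗[R] H →ₗc[R] H ⊗[R] H :=
    ((Coalgebra.TensorProduct.lid R (H ⊗[R] H)).toCoalgHom.comp
      (Coalgebra.TensorProduct.map (Coalgebra.counitCoalgHom R H) (.id R _))).comp
        (Coalgebra.TensorProduct.assoc R R H H H).toCoalgHom
  let mp : (H ⊗[R] H) ⊗[R] H →ₗc[R] H ⊗[R] H :=
    (Coalgebra.TensorProduct.map (.id R _) (Bialgebra.mulCoalgHom R H)).comp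
      (Coalgebra.TensorProduct.assoc R R H H H).toCoalgHom
  have e12 (f : H ⊗[R] H →ₗ[R] R) :
      toConv (LinearMap.mul' R R ∘ₗ map f (counit (R := R))) = convPullback p12 (toConv f) := by
    apply congrArg toConv; ext x y z; simp [p12, mul_comm]
  have em (f : H ⊗[R] H →ₗ[R] R) :
      toConv (f ∘ₗ map (mulH R H) LinearMap.id) = convPullback pm (toConv f) := by
    apply congrArg toConv; ext x y z; simp [pm]
  have e23 (f : H ⊗[R] H →ₗ[R] R) :
      toConv (LinearMap.mul' R R ∘ₗ map (counit (R := R)) f ∘ₗ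
        (TensorProduct.assoc R H H H).toLinearMap) = convPullback p23 (toConv f) := by
    apply congrArg toConv; ext x y z; simp [p23]
  have me (f : H ⊗[R] H →ₗ[R] R) :
      toConv (f ∘ₗ map LinearMap.id (mulH R H) ∘ₗ (TensorProduct.assoc R H H H).toLinearMap) =
        convPullback mp (toConv f) := by
    apply congrArg toConv; ext x y z; simp [mp]
  have hc : convPullback p12 (toConv γ) * convPullback pm (toConv γ) =
      convPullback p23 (toConv γ) * convPullback mp (toConv γ) := by
    rw [← e12, ← em, ← e23, ← me]
    exact congrArg toConv hco.cocycle
  obtain ⟨h1, h2⟩ := hco.convMul_inverse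
  let u : (WithConv (H ⊗[R] H →ₗ[R] R))ˣ := ⟨toConv γ, toConv γ', h1, h2⟩
  have hu : Units.map (convPullback p12) u * Units.map (convPullback pm) u =
      Units.map (convPullback p23) u * Units.map (convPullback mp) u := Units.ext hc
  have := congrArg (fun v => ((v⁻¹ : (WithConv ((H ⊗[R] H) ⊗[R] H →ₗ[R] R))ˣ) :
    WithConv ((H ⊗[R] H) ⊗[R] H →ₗ[R] R))) hu
  simp only [mul_inv_rev, Units.val_mul] at this
  rw [e12, em, e23, me]
  exact this

/-- The identity `γ'(g₍₁₎x₍₁₎ ⊗ y₍₁₎k₍₁₎) γ'(y₍₂₎ ⊗ k₍₂₎) γ'(g₍₂₎ ⊗ x₍₂₎) γ(x₍₃₎ ⊗ y₍₃₎) =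
γ'(g ⊗ x₍₁₎y₍₁₎k₍₁₎) γ'(x₍₂₎y₍₂₎ ⊗ k₍₂₎)`. -/
theorem IsCocycle.four_variable_identity {γ γ' : H ⊗[R] H →ₗ[R] R}
    (hco : IsCocycle R H (mulH R H) γ γ') :
    toConv ((γ' ∘ₗ map LinearMap.id (mulH R H)) ∘ₗ mulLeft₃ R H) *
      (toConv (counitLeft γ' ∘ₗ mulLeft₃ R H) *
        (toConv (counitRight γ') * toConv (counitLeft (counitRight γ)))) =
    toConv (γ' ∘ₗ map LinearMap.id (mulH R H ∘ₗ mulLeft₂ R H)) *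
      toConv (counitLeft (γ' ∘ₗ mulLeft₂ R H)) := by
  let q₁ : H ⊗[R] (H ⊗[R] (H ⊗[R] H)) →ₗc[R] (H ⊗[R] H) ⊗[R] H :=
    (Coalgebra.TensorProduct.assoc R R H H H).symm.toCoalgHom.comp
      (Coalgebra.TensorProduct.map (.id R _)
        (Coalgebra.TensorProduct.map (.id R _) (Bialgebra.mulCoalgHom R H)))
  let q₂ : H ⊗[R] (H ⊗[R] (H ⊗[R] H)) →ₗc[R] (H ⊗[R] H) ⊗[R] H :=
    (Coalgebra.TensorProduct.assoc R R H H H).symm.toCoalgHom.comp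
      ((Coalgebra.TensorProduct.lid R (H ⊗[R] (H ⊗[R] H))).toCoalgHom.comp
        (Coalgebra.TensorProduct.map (Coalgebra.counitCoalgHom R H) (.id R _)))
  let p₁ : H ⊗[R] (H ⊗[R] (H ⊗[R] H)) →ₗc[R] (H ⊗[R] H) ⊗[R] (H ⊗[R] H) :=
    (Coalgebra.TensorProduct.assoc R R H H (H ⊗[R] H)).symm.toCoalgHom
  let q₃ : H ⊗[R] (H ⊗[R] (H ⊗[R] H)) →ₗc[R] H ⊗[R] H :=
    ((Coalgebra.TensorProduct.rid R R (H ⊗[R] H)).toCoalgHom.comp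
      (Coalgebra.TensorProduct.map (.id R _) (Coalgebra.counitCoalgHom R H))).comp q₂
  have h₁ := congrArg (convPullback q₁) hco.inverse_cocycle
  have h₂ := congrArg (convPullback q₂) hco.inverse_cocycle
  have h₃ := congrArg (convPullback q₃) hco.convMul_inverse.2
  rw [map_mul, map_mul] at h₁ h₂
  rw [map_mul, map_one] at h₃
  have hcomm : toConv (counitLeft γ' ∘ₗ mulLeft₃ R H) * toConv (counitRight γ') =
      toConv (counitRight γ') * toConv (counitLeft γ' ∘ₗ mulLeft₃ R H) := by
    have hl : toConv (counitLeft γ' ∘ₗ mulLeft₃ R H) = convPullback p₁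
        (toConv (LinearMap.mul' R R ∘ₗ map (1 : WithConv (H ⊗[R] H →ₗ[R] R)).ofConv γ')) := by
      apply congrArg toConv; ext g x y k
      simp [p₁, counitLeft, mulLeft₃, LinearMap.convOne_def, mul_comm]
    have hr : toConv (counitRight γ') = convPullback p₁
        (toConv (LinearMap.mul' R R ∘ₗ map γ' (1 : WithConv (H ⊗[R] H →ₗ[R] R)).ofConv)) := by
      apply congrArg toConv; ext g x y k
      simp [p₁, counitRight, LinearMap.convOne_def]
    rw [hl, hr, ← map_mul, ← map_mul]
    congr 1
    exact (toConv_mul'_map_mul 1 (toConv γ') (toConv γ') 1).trans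
      (by rw [toConv_mul'_map_mul (toConv γ') 1 1 (toConv γ')]; simp only [one_mul, mul_one])
  have ea : toConv ((γ' ∘ₗ map LinearMap.id (mulH R H)) ∘ₗ mulLeft₃ R H) =
      convPullback q₁ (toConv (γ' ∘ₗ map (mulH R H) LinearMap.id)) := by
    apply congrArg toConv; ext g x y k; simp [q₁, mulLeft₃]
  have eb : toConv (counitRight γ') =
      convPullback q₁ (toConv (LinearMap.mul' R R ∘ₗ map γ' (counit (R := R)))) := by
    apply congrArg toConv; ext g x y k; simp [q₁, counitRight, mul_comm]
  have ec : toConv (counitLeft (counitRight γ)) = convPullback q₃ (toConv γ) := by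
    apply congrArg toConv; ext g x y k; simp [q₃, q₂, counitRight, counitLeft]; ring
  have ec' : convPullback q₂ (toConv (LinearMap.mul' R R ∘ₗ map γ' (counit (R := R)))) =
      convPullback q₃ (toConv γ') := by
    apply congrArg toConv; ext g x y k; simp [q₃, q₂]; ring
  have ed : toConv (counitLeft γ' ∘ₗ mulLeft₃ R H) =
      convPullback q₂ (toConv (LinearMap.mul' R R ∘ₗ map (counit (R := R)) γ' ∘ₗ
        (TensorProduct.assoc R H H H).toLinearMap)) := by
    apply congrArg toConv; ext g x y k; simp [q₂, counitLeft, mulLeft₃, mul_assoc]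
  have en₁ : toConv (γ' ∘ₗ map LinearMap.id (mulH R H ∘ₗ mulLeft₂ R H)) =
      convPullback q₁ (toConv (γ' ∘ₗ map LinearMap.id (mulH R H) ∘ₗ
        (TensorProduct.assoc R H H H).toLinearMap)) := by
    apply congrArg toConv; ext g x y k; simp [q₁, mulLeft₂, mul_assoc]
  have en₂ : toConv (counitLeft (γ' ∘ₗ mulLeft₂ R H)) =
      convPullback q₂ (toConv (γ' ∘ₗ map (mulH R H) LinearMap.id)) := by
    apply congrArg toConv; ext g x y k; simp [q₂, counitLeft, mulLeft₂]
  have ee : convPullback q₁ (toConv (LinearMap.mul' R R ∘ₗ map (counit (R := R)) γ' ∘ₗ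
        (TensorProduct.assoc R H H H).toLinearMap)) =
      convPullback q₂ (toConv (γ' ∘ₗ map LinearMap.id (mulH R H) ∘ₗ
        (TensorProduct.assoc R H H H).toLinearMap)) := by
    apply congrArg toConv; ext g x y k; simp [q₁, q₂]
  rw [← mul_assoc (toConv (counitLeft γ' ∘ₗ mulLeft₃ R H)), hcomm, mul_assoc, ← mul_assoc,
    ea, eb, h₁, mul_assoc, ee, ed, ← mul_assoc (convPullback q₂ _), ← h₂, ec', mul_assoc, ec, h₃,
    mul_one, ← en₁, ← en₂]

end Cocycle
section CanonicalMap

variable {R H : Type*} [CommRing R] [Ring H] [HopfAlgebra R H]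

theorem coact_comp {V C D : Type*} [AddCommGroup V] [Module R V] [AddCommGroup C] [Module R C]
    [AddCommGroup D] [Module R D] (δ : V →ₗ[R] V ⊗[R] C) (f : D →ₗ[R] R) (g : C →ₗ[R] D) :
    coact δ (f ∘ₗ g) = coact (map LinearMap.id g ∘ₗ δ) f := by
  have h : map (LinearMap.id (M := V)) (f ∘ₗ g) = map LinearMap.id f ∘ₗ map LinearMap.id g := by
    rw [← map_comp, LinearMap.id_comp]
  rw [coact, h, LinearMap.comp_assoc, coact]

theorem leftBiAdjoint_mulLeft₂ :
    map LinearMap.id (mulLeft₂ R H) ∘ₗ leftBiAdjoint R H =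
      map LinearMap.id (TensorProduct.mk R H H 1) ∘ₗ comul (R := R) := by
  have h1 : mulH R H ∘ₗ map LinearMap.id (Sa R H) ∘ₗ comul (R := R) =
      Algebra.linearMap R H ∘ₗ counit (R := R) := HopfAlgebra.mul_antipode_lTensor_comul
  rw [mulLeft₂, leftBiAdjoint_contract, h1]
  have h2 : map (Algebra.linearMap R H ∘ₗ counit (R := R) (A := H)) (comul (R := R) (A := H)) =
      map (Algebra.linearMap R H) (comul (R := R) (A := H)) ∘ₗ
        map (counit (R := R) (A := H)) LinearMap.id := by
    rw [← map_comp, LinearMap.comp_id]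
  ext h
  have h3 := Coalgebra.rTensor_counit_comul (R := R) h
  rw [LinearMap.rTensor] at h3
  simp only [h2, LinearMap.comp_apply, h3, map_tmul, Algebra.linearMap_apply, map_one]
  induction comul (R := R) h using TensorProduct.induction_on with
  | zero => simp
  | add x y hx hy => simp only [map_add, tmul_add, hx, hy]
  | tmul x y => simp

theorem coact_leftBiAdjoint_mulLeft₂ {γ γ' : H ⊗[R] H →ₗ[R] R}
    (hco : IsCocycle R H (mulH R H) γ γ') :
    coact (leftBiAdjoint R H) (γ' ∘ₗ mulLeft₂ R H) = LinearMap.id := by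
  have h2 : γ' ∘ₗ TensorProduct.mk R H H 1 = counit (R := R) := by
    ext h; simp [hco.inverse_one_tmul]
  rw [coact_comp, leftBiAdjoint_mulLeft₂, ← coact_comp, h2, coact]
  ext h
  have h3 := Coalgebra.lTensor_counit_comul (R := R) h
  rw [LinearMap.lTensor] at h3
  simp [h3]

/-- The map `h ↦ u(h₍₁₎) h₍₂₎`. -/
noncomputable def leftHit (u : H →ₗ[R] R) : H →ₗ[R] H :=
  (TensorProduct.lid R H).toLinearMap ∘ₗ map u LinearMap.id ∘ₗ comul (R := R)

theorem coact_leftBiAdjoint_counitRight (γ : H ⊗[R] H →ₗ[R] R) :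
    coact (leftBiAdjoint R H) (counitRight γ) = leftHit (uMap R H γ) := by
  have h1 : coact (leftBiAdjoint R H) (counitRight γ) =
      ((TensorProduct.rid R H).toLinearMap ∘ₗ
        map LinearMap.id ((TensorProduct.lid R R).toLinearMap ∘ₗ
          map LinearMap.id (counit (R := R)))) ∘ₗ
      map LinearMap.id (map γ LinearMap.id ∘ₗ
        (TensorProduct.assoc R H H H).symm.toLinearMap) ∘ₗ leftBiAdjoint R H := by
    have : counitRight γ = ((TensorProduct.lid R R).toLinearMap ∘ₗ
        map LinearMap.id (counit (R := R))) ∘ₗ (map γ LinearMap.id ∘ₗ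
        (TensorProduct.assoc R H H H).symm.toLinearMap) := by
      ext x y k; simp [counitRight]
    rw [this, coact_comp, coact, LinearMap.comp_assoc]
  rw [h1, leftBiAdjoint_contract]
  ext h
  simp only [leftHit, LinearMap.comp_apply]
  induction comul (R := R) h using TensorProduct.induction_on with
  | zero => simp
  | add x y hx hy => simp only [map_add, hx, hy]
  | tmul x y =>
    have h3 := Coalgebra.lTensor_counit_comul (R := R) y
    rw [LinearMap.lTensor] at h3
    have h4 (r : R) (t : H ⊗[R] H) : TensorProduct.rid R H (map LinearMap.id
        ((TensorProduct.lid R R).toLinearMap ∘ₗ map LinearMap.id (counit (R := R)))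
        (TensorProduct.leftComm R R H H (r ⊗ₜ t))) =
        r • TensorProduct.rid R H (map LinearMap.id (counit (R := R)) t) := by
      induction t using TensorProduct.induction_on with
      | zero => simp
      | add x y hx hy => simp only [map_add, tmul_add, smul_add, hx, hy]
      | tmul x y => simp [smul_smul]
    simp only [map_tmul, LinearEquiv.coe_coe, h4, h3]
    simp [uMap]

theorem Qmap_eq (γ γ' : H ⊗[R] H →ₗ[R] R) :
    Qmap R H γ γ' = coact (biAdjoint R H) γ' ∘ₗ leftHit (uMap R H γ) := by
  let e : H ⊗[R] ((H ⊗[R] H) ⊗[R] H) →ₗ[R] ((H ⊗[R] H) ⊗[R] H) ⊗[R] H :=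
    map (TensorProduct.assoc R H H H).symm.toLinearMap LinearMap.id ∘ₗ
      (TensorProduct.assoc R H (H ⊗[R] H) H).symm.toLinearMap
  have hcoassoc : comul4 R H = e ∘ₗ map LinearMap.id (comul3 R H) ∘ₗ comul (R := R) := by
    simp only [e, comul4, comul3, coassoc_simps]
  rw [Qmap, hcoassoc]
  ext h
  simp only [coact, biAdjoint, leftHit, LinearMap.comp_apply]
  induction comul (R := R) h using TensorProduct.induction_on with
  | zero => simp
  | add x y hx hy => simp only [map_add, hx, hy]
  | tmul x l =>
    simp only [map_tmul, id_apply, LinearEquiv.coe_coe, lid_tmul, map_smul]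
    induction comul3 R H l using TensorProduct.induction_on with
    | zero => simp
    | add x y hx hy => simp only [map_add, tmul_add, smul_add, hx, hy]
    | tmul y k =>
      induction y using TensorProduct.induction_on with
      | zero => simp
      | add x y hx hy => simp only [map_add, add_tmul, tmul_add, smul_add, hx, hy]
      | tmul q m => simp [e, smul_smul, mul_comm]

variable {A : Type*} [Ring A] [Algebra R A] {δ : A →ₗ[R] A ⊗[R] H}

theorem tensorCoaction_biAdjoint_comp (hδ : IsCoassoc δ) :
    tensorCoaction δ (biAdjoint R H) ∘ₗ δ =
      (TensorProduct.assoc R A H (H ⊗[R] (H ⊗[R] H))).symm.toLinearMap ∘ₗ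
        map LinearMap.id (leftBiAdjoint R H) ∘ₗ δ := by
  let s : A ⊗[R] (H ⊗[R] H) →ₗ[R] (A ⊗[R] H) ⊗[R] (H ⊗[R] (H ⊗[R] H)) :=
    (TensorProduct.assoc R A H (H ⊗[R] (H ⊗[R] H))).symm.toLinearMap ∘ₗ
      map LinearMap.id ((TensorProduct.leftComm R H H (H ⊗[R] H)).toLinearMap ∘ₗ
        map LinearMap.id (biAdjoint R H))
  have h1 : tensorCoaction δ (biAdjoint R H) ∘ₗ δ = s ∘ₗ
      ((TensorProduct.assoc R A H H).toLinearMap ∘ₗ map δ LinearMap.id ∘ₗ δ) := by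
    ext a
    simp only [tensorCoaction, LinearMap.comp_apply]
    induction δ a using TensorProduct.induction_on with
    | zero => simp
    | add x y hx hy => simp only [map_add, hx, hy]
    | tmul x h =>
      simp only [map_tmul, id_apply, LinearEquiv.coe_coe]
      induction δ x using TensorProduct.induction_on with
      | zero => simp
      | add x y hx hy => simp only [map_add, add_tmul, hx, hy]
      | tmul x g =>
        simp only [s, assoc_tmul, LinearMap.comp_apply, map_tmul, id_apply, LinearEquiv.coe_coe]
        induction biAdjoint R H h using TensorProduct.induction_on with
        | zero => simp
        | add x y hx hy => simp only [map_add, tmul_add, hx, hy]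
        | tmul m w => simp
  rw [h1, hδ]
  simp only [s, leftBiAdjoint, LinearMap.comp_assoc]
  rw [← LinearMap.comp_assoc δ, ← map_comp, LinearMap.id_comp, LinearMap.comp_assoc]

theorem coact_tensorCoaction_biAdjoint_comp (hδ : IsCoassoc δ)
    (f : H ⊗[R] (H ⊗[R] H) →ₗ[R] R) :
    coact (tensorCoaction δ (biAdjoint R H)) f ∘ₗ δ =
      map LinearMap.id (coact (leftBiAdjoint R H) f) ∘ₗ δ := by
  rw [coact, LinearMap.comp_assoc, LinearMap.comp_assoc, tensorCoaction_biAdjoint_comp hδ]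
  ext a
  simp only [coact, LinearMap.comp_apply]
  induction δ a using TensorProduct.induction_on with
  | zero => simp
  | add x y hx hy => simp only [map_add, hx, hy]
  | tmul x h =>
    simp only [map_tmul, id_apply, LinearMap.comp_apply]
    induction leftBiAdjoint R H h using TensorProduct.induction_on with
    | zero => simp
    | add x y hx hy => simp only [map_add, tmul_add, hx, hy]
    | tmul m w => simp

/-- The action of a functional trivial on the first factor. -/
theorem coact_tensorCoaction_counitLeft {C V W : Type*} [AddCommGroup C] [Module R C]
    [Coalgebra R C] [AddCommGroup V] [Module R V] [AddCommGroup W] [Module R W]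
    {D : Type*} [AddCommGroup D] [Module R D]
    {δV : V →ₗ[R] V ⊗[R] C} (hV : coact δV (counit (R := R)) = LinearMap.id)
    (δW : W →ₗ[R] W ⊗[R] D) (f : D →ₗ[R] R) :
    coact (tensorCoaction δV δW) (counitLeft f) = map LinearMap.id (coact δW f) := by
  rw [← hV]
  ext v w
  simp only [coact, tensorCoaction, AlgebraTensorModule.curry_apply, curry_apply,
    LinearMap.coe_restrictScalars, LinearMap.comp_apply, map_tmul]
  induction δV v using TensorProduct.induction_on with
  | zero => simp
  | add x y hx hy => simp only [map_add, hx, hy, add_tmul]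
  | tmul x c =>
    induction δW w using TensorProduct.induction_on with
    | zero => simp
    | add x y hx hy => simp only [map_add, hx, hy, tmul_add]
    | tmul y d => simp [counitLeft, smul_tmul', tmul_smul, smul_smul, mul_comm]

variable (R H A) in
/-- The map `a ⊗ (a' ⊗ h) ↦ aa' ⊗ h`. -/
noncomputable def mulLeftA : A ⊗[R] (A ⊗[R] H) →ₗ[R] A ⊗[R] H :=
  map (LinearMap.mul' R A) LinearMap.id ∘ₗ (TensorProduct.assoc R A A H).symm.toLinearMap

theorem coact_comp_mulLeftA (hmul : ∀ a b : A, δ (a * b) = δ a * δ b)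
    (f : H ⊗[R] (H ⊗[R] H) →ₗ[R] R) :
    coact (tensorCoaction δ (biAdjoint R H)) f ∘ₗ mulLeftA R H A =
      mulLeftA R H A ∘ₗ
        coact (tensorCoaction δ (tensorCoaction δ (biAdjoint R H))) (f ∘ₗ mulLeft₃ R H) := by
  ext a b h
  simp only [coact, tensorCoaction, mulLeftA, AlgebraTensorModule.curry_apply, curry_apply,
    LinearMap.coe_restrictScalars, LinearMap.comp_apply, map_tmul, LinearEquiv.coe_coe,
    assoc_symm_tmul, LinearMap.mul'_apply, hmul, id_apply]
  induction δ a using TensorProduct.induction_on with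
  | zero => simp
  | add x y hx hy => simp only [map_add, hx, hy, add_tmul, add_mul]
  | tmul x g =>
    induction δ b using TensorProduct.induction_on with
    | zero => simp
    | add x y hx hy => simp only [map_add, hx, hy, add_tmul, tmul_add, mul_add]
    | tmul y k =>
      induction biAdjoint R H h using TensorProduct.induction_on with
      | zero => simp
      | add x y hx hy => simp only [map_add, hx, hy, tmul_add]
      | tmul m w => simp [mulLeft₃]

theorem map_mulAg_eq (γ' : H ⊗[R] H →ₗ[R] R) :
    map (mulAg R H A δ γ') LinearMap.id ∘ₗ (TensorProduct.assoc R A A H).symm.toLinearMap =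
      mulLeftA R H A ∘ₗ
        coact (tensorCoaction δ (tensorCoaction δ (biAdjoint R H))) (counitRight γ') := by
  conv_lhs => rw [← coact_biAdjoint_counit R H]
  ext a b h
  simp only [coact, tensorCoaction, mulLeftA, mulAg, AlgebraTensorModule.curry_apply, curry_apply,
    LinearMap.coe_restrictScalars, LinearMap.comp_apply, map_tmul, LinearEquiv.coe_coe,
    assoc_symm_tmul]
  induction δ a using TensorProduct.induction_on with
  | zero => simp
  | add x y hx hy => simp only [map_add, hx, hy, add_tmul]
  | tmul x g =>
    induction δ b using TensorProduct.induction_on with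
    | zero => simp
    | add x y hx hy => simp only [map_add, hx, hy, add_tmul, tmul_add]
    | tmul y k =>
      induction biAdjoint R H h using TensorProduct.induction_on with
      | zero => simp
      | add x y hx hy => simp only [map_add, hx, hy, tmul_add]
      | tmul m w => simp [counitRight, smul_tmul', tmul_smul, smul_smul, mul_comm]

theorem chiMap_comp_phiMap (hδ : IsCoassoc δ) (γ' : H ⊗[R] H →ₗ[R] R) :
    chiMap R H A (LinearMap.mul' R A) δ ∘ₗ phiMap R H A A δ δ γ' =
      mulLeftA R H A ∘ₗ coact (tensorCoaction δ (tensorCoaction δ (biAdjoint R H)))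
        (γ' ∘ₗ map LinearMap.id (mulH R H ∘ₗ mulLeft₂ R H)) ∘ₗ map LinearMap.id δ := by
  let s : (A ⊗[R] H) ⊗[R] (A ⊗[R] (H ⊗[R] H)) →ₗ[R] A ⊗[R] H :=
    mulLeftA R H A ∘ₗ (TensorProduct.rid R (A ⊗[R] (A ⊗[R] H))).toLinearMap ∘ₗ
      map LinearMap.id γ' ∘ₗ (tensorTensorTensorComm R A H (A ⊗[R] H) H).toLinearMap ∘ₗ
        map LinearMap.id (TensorProduct.assoc R A H H).symm.toLinearMap
  have hl : chiMap R H A (LinearMap.mul' R A) δ ∘ₗ phiMap R H A A δ δ γ' =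
      s ∘ₗ map δ ((TensorProduct.assoc R A H H).toLinearMap ∘ₗ map δ LinearMap.id ∘ₗ δ) := by
    ext a b
    simp only [chiMap, phiMap, AlgebraTensorModule.curry_apply, curry_apply,
      LinearMap.coe_restrictScalars, LinearMap.comp_apply, map_tmul]
    induction δ a using TensorProduct.induction_on with
    | zero => simp
    | add x y hx hy => simp only [map_add, hx, hy, add_tmul]
    | tmul x g =>
      induction δ b using TensorProduct.induction_on with
      | zero => simp
      | add x y hx hy => simp only [map_add, hx, hy, tmul_add]
      | tmul y h =>
        simp only [map_tmul, id_apply, LinearEquiv.coe_coe, tensorTensorTensorComm_tmul, rid_tmul,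
          map_smul]
        induction δ y using TensorProduct.induction_on with
        | zero => simp
        | add x y hx hy => simp only [map_add, hx, hy, tmul_add, add_tmul, smul_add]
        | tmul y k => simp [s, mulLeftA]
  have hmul : map LinearMap.id (mulH R H ∘ₗ mulLeft₂ R H) ∘ₗ leftBiAdjoint R H =
      comul (R := R) := by
    rw [← LinearMap.id_comp LinearMap.id, map_comp, LinearMap.comp_assoc, leftBiAdjoint_mulLeft₂,
      ← LinearMap.comp_assoc, ← map_comp]
    have : mulH R H ∘ₗ TensorProduct.mk R H H 1 = LinearMap.id := by ext; simp
    rw [this, LinearMap.id_comp, map_id, LinearMap.id_comp]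
  rw [hl, hδ, ← hmul]
  ext a b
  have hb := LinearMap.congr_fun (tensorCoaction_biAdjoint_comp hδ) b
  simp only [LinearMap.comp_apply] at hb
  rw [coact, tensorCoaction]
  simp only [AlgebraTensorModule.curry_apply, curry_apply,
    LinearMap.coe_restrictScalars, LinearMap.comp_apply, map_tmul, hb, id_apply]
  induction δ a using TensorProduct.induction_on with
  | zero => simp
  | add x y hx hy => simp only [map_add, hx, hy, add_tmul]
  | tmul x g =>
    induction δ b using TensorProduct.induction_on with
    | zero => simp
    | add x y hx hy => simp only [map_add, hx, hy, tmul_add]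
    | tmul y h =>
      simp only [map_tmul, LinearMap.comp_apply, id_apply]
      induction leftBiAdjoint R H h using TensorProduct.induction_on with
      | zero => simp
      | add x y hx hy => simp only [map_add, hx, hy, tmul_add]
      | tmul m w => simp [s]

theorem map_Qmap_comp_chiMap (hδ : IsCoassoc δ) (hε : coact δ (counit (R := R)) = LinearMap.id)
    (γ γ' : H ⊗[R] H →ₗ[R] R) :
    map LinearMap.id (Qmap R H γ γ') ∘ₗ chiMap R H A (mulAg R H A δ γ') δ =
      coact (tensorCoaction δ (biAdjoint R H)) (counitLeft γ') ∘ₗ mulLeftA R H A ∘ₗ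
        coact (tensorCoaction δ (tensorCoaction δ (biAdjoint R H))) (counitRight γ') ∘ₗ
        coact (tensorCoaction δ (tensorCoaction δ (biAdjoint R H)))
          (counitLeft (counitRight γ)) ∘ₗ map LinearMap.id δ := by
  have hu : map LinearMap.id (leftHit (uMap R H γ)) ∘ₗ chiMap R H A (mulAg R H A δ γ') δ =
      (map (mulAg R H A δ γ') LinearMap.id ∘ₗ (TensorProduct.assoc R A A H).symm.toLinearMap) ∘ₗ
        map LinearMap.id (map LinearMap.id (leftHit (uMap R H γ)) ∘ₗ δ) := by
    ext a b
    simp only [chiMap, AlgebraTensorModule.curry_apply, curry_apply,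
      LinearMap.coe_restrictScalars, LinearMap.comp_apply, map_tmul]
    induction δ b using TensorProduct.induction_on with
    | zero => simp
    | add x y hx hy => simp only [map_add, hx, hy, tmul_add]
    | tmul y h => simp
  have hQ : map (LinearMap.id (M := A)) (Qmap R H γ γ') =
      map LinearMap.id (coact (biAdjoint R H) γ') ∘ₗ
        map LinearMap.id (leftHit (uMap R H γ)) := by
    rw [← map_comp, Qmap_eq, LinearMap.id_comp]
  rw [hQ, LinearMap.comp_assoc, hu, map_mulAg_eq, ← coact_leftBiAdjoint_counitRight,
    ← coact_tensorCoaction_biAdjoint_comp hδ, coact_tensorCoaction_counitLeft hε,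
    coact_tensorCoaction_counitLeft hε, LinearMap.comp_assoc]
  rw [← map_comp, LinearMap.id_comp]

end CanonicalMap

/-- commutativity of the diagram relating the twisted canonical map
`χ_γ(a⊗a') = (a •_γ a'₍₀₎) ⊗ a'₍₁₎` to the original canonical map:
`φ_{A,H} ∘ (id ⊗ Q) ∘ χ_γ = χ ∘ φ_{A,A}` (stated on `A ⊗ A`). -/
theorem twisted_canonical_map_diagram (F H A : Type*) [Field F] [Ring H]
    [HopfAlgebra F H] [Ring A] [Algebra F A]
    (hS : Function.Bijective (Sa F H))
    (δ : A →ₗ[F] A ⊗[F] H) (hδ : IsComodAlg F H A δ)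
    (γ γ' : H ⊗[F] H →ₗ[F] F) (hco : IsCocycle F H (mulH F H) γ γ') :
    ((TensorProduct.rid F (A ⊗[F] H)).toLinearMap ∘ₗ map LinearMap.id γ'
        ∘ₗ (tensorTensorTensorComm F A H H H).toLinearMap ∘ₗ map δ (Ad F H))
      ∘ₗ map LinearMap.id (Qmap F H γ γ')
      ∘ₗ chiMap F H A (mulAg F H A δ γ') δ
    = chiMap F H A (LinearMap.mul' F A) δ ∘ₗ phiMap F H A A δ δ γ' := by
  obtain ⟨⟨hδ, hε⟩, hmul, -⟩ := hδ
  replace hδ : IsCoassoc δ := hδ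
  replace hε : coact δ (counit (R := F)) = LinearMap.id := hε
  have hσ := hδ.tensor (hδ.tensor (isCoassoc_biAdjoint F H))
  have hφ : (TensorProduct.rid F (A ⊗[F] H)).toLinearMap ∘ₗ map LinearMap.id γ'
        ∘ₗ (tensorTensorTensorComm F A H H H).toLinearMap ∘ₗ map δ (Ad F H) =
      coact (tensorCoaction δ (biAdjoint F H)) (γ' ∘ₗ map LinearMap.id (mulH F H)) := by
    have hAd : Ad F H = map LinearMap.id (mulH F H) ∘ₗ biAdjoint F H := rfl
    rw [hAd]
    ext a h
    simp only [coact, tensorCoaction, AlgebraTensorModule.curry_apply, curry_apply,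
      LinearMap.coe_restrictScalars, LinearMap.comp_apply, map_tmul]
    induction δ a using TensorProduct.induction_on with
    | zero => simp
    | add x y hx hy => simp only [map_add, hx, hy, add_tmul]
    | tmul x g =>
      induction biAdjoint F H h using TensorProduct.induction_on with
      | zero => simp
      | add x y hx hy => simp only [map_add, hx, hy, tmul_add]
      | tmul m w => simp
  have hn : coact (tensorCoaction δ (tensorCoaction δ (biAdjoint F H)))
      (counitLeft (γ' ∘ₗ mulLeft₂ F H)) ∘ₗ map LinearMap.id δ = map LinearMap.id δ := by
    rw [coact_tensorCoaction_counitLeft hε, ← map_comp, coact_tensorCoaction_biAdjoint_comp hδ,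
      coact_leftBiAdjoint_mulLeft₂ hco, map_id, LinearMap.id_comp, LinearMap.id_comp]
  have key := congrArg
    (fun f => coact (tensorCoaction δ (tensorCoaction δ (biAdjoint F H))) f.ofConv)
    hco.four_variable_identity
  simp only [← hσ.coact_comp_coact] at key
  rw [hφ, map_Qmap_comp_chiMap hδ hε, chiMap_comp_phiMap hδ,
    ← LinearMap.comp_assoc _ (mulLeftA F H A), coact_comp_mulLeftA hmul, LinearMap.comp_assoc,
    ← LinearMap.comp_assoc _ (mulLeftA F H A), coact_comp_mulLeftA hmul, LinearMap.comp_assoc]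
  conv_rhs => rw [← hn, ← LinearMap.comp_assoc (map _ _), ← key]
  simp only [LinearMap.comp_assoc]
end
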